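/- arXiv:1905.02287 — 2 statements merged into one kernel-verified Lean document; each statement's English description precedes it below -/
import Mathlib

section
/- For every integer n ≥ 4, there exists a gross substitutes valuation v defined on all subsets of [n] (with ground set exactly [n]) that does not belong to MBV_{n,n}. In particular, MBV_{n,n} is a strict subclass of the class of gross substitutes valuations on subsets of [n]. -/
open Finset

variable {α : Type*} [DecidableEq α]

/-- A valuation on ground set `E`: zero at the empty set, non-negative,
and monotone on subsets of `E`. -/
def IsValuation (E : Finset α) (u : Finset α → ℝ) : Prop :=
  u ∅ = 0 ∧ (∀ S : Finset α, S ⊆ E → 0 ≤ u S) ∧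
    ∀ ⦃S T : Finset α⦄, S ⊆ T → T ⊆ E → u S ≤ u T

/-- Gross substitutes valuation on ground set `E`: a valuation satisfying the
M♮-exchange property. -/
def GrossSubstitutes (E : Finset α) (u : Finset α → ℝ) : Prop :=
  IsValuation E u ∧
    ∀ ⦃S T : Finset α⦄, S ⊆ E → T ⊆ E → ∀ i ∈ S \ T,
      u S + u T ≤ u (S.erase i) + u (insert i T) ∨
        ∃ j ∈ T \ S,
          u S + u T ≤ u (insert j (S.erase i)) + u ((insert i T).erase j)

/-- The merge (convolution) of a valuation `u1` on `E1` and `u2` on `E2`: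
`(u1 * u2)(S) = max { u1 S1 + u2 S2 : S = S1 ∪ S2, S1 ∩ S2 = ∅, S1 ⊆ E1, S2 ⊆ E2 }`. -/
noncomputable def mergeVal (E1 E2 : Finset α) (u1 u2 : Finset α → ℝ)
    (S : Finset α) : ℝ :=
  sSup {x : ℝ | ∃ S1 S2 : Finset α, S = S1 ∪ S2 ∧ Disjoint S1 S2 ∧
    S1 ⊆ E1 ∧ S2 ⊆ E2 ∧ x = u1 S1 + u2 S2}

/-- A (finite) matroid with ground set `E`, given by its independent sets. -/
structure FinMatroid (α : Type*) [DecidableEq α] where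
  E : Finset α
  Indep : Finset α → Prop
  indep_empty : Indep ∅
  indep_subset : ∀ ⦃I J : Finset α⦄, Indep J → I ⊆ J → Indep I
  indep_aug : ∀ ⦃I J : Finset α⦄, Indep I → Indep J → I.card < J.card →
    ∃ e ∈ J, e ∉ I ∧ Indep (insert e I)
  subset_ground : ∀ ⦃I : Finset α⦄, Indep I → I ⊆ E

/-- The weighted matroid rank valuation:
`ρ^w(T) = max { ∑_{i ∈ I} w i : I independent, I ⊆ T }`. -/
noncomputable def weightedRank (M : FinMatroid α) (w : α → ℝ) (T : Finset α) : ℝ :=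
  sSup {x : ℝ | ∃ I : Finset α, M.Indep I ∧ I ⊆ T ∧ x = ∑ i ∈ I, w i}

/-- `M` is the matroid union of `M1` and `M2`. -/
def IsMatroidUnion (M M1 M2 : FinMatroid α) : Prop :=
  M.E = M1.E ∪ M2.E ∧
    ∀ I : Finset α, M.Indep I ↔
      ∃ I1 I2 : Finset α, M1.Indep I1 ∧ M2.Indep I2 ∧ I = I1 ∪ I2

/-- A matroid is irreducible under matroid union if whenever it is a union of
two matroids, one of them equals the matroid itself. -/
def MatroidIrreducible (M : FinMatroid α) : Prop :=
  ∀ M1 M2 : FinMatroid α, IsMatroidUnion M M1 M2 → M1 = M ∨ M2 = M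

/-- `MBV n` : the smallest class of valuations on subsets of `[n]` containing
all weighted matroid rank valuations of matroids on subsets of `[n]` and
closed under merging and endowment. `MBV n E u` says the valuation `u` with
ground set `E` is in the class. -/
inductive MBV (n : ℕ) : Finset (Fin n) → (Finset (Fin n) → ℝ) → Prop
  | wrank (M : FinMatroid (Fin n)) (w : Fin n → ℝ) (hw : ∀ i, 0 ≤ w i) :
      MBV n M.E (weightedRank M w)
  | merge {E1 E2 : Finset (Fin n)} {u1 u2 : Finset (Fin n) → ℝ} :
      MBV n E1 u1 → MBV n E2 u2 → MBV n (E1 ∪ E2) (mergeVal E1 E2 u1 u2)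
  | endow {E : Finset (Fin n)} {u : Finset (Fin n) → ℝ} (T : Finset (Fin n))
      (hT : T ⊆ E) : MBV n E u → MBV n (E \ T) (fun S => u (S ∪ T) - u T)

section Merge

lemma mergeVal_set_finite (E1 E2 : Finset α) (u1 u2 : Finset α → ℝ) (S : Finset α) :
    {x : ℝ | ∃ S1 S2 : Finset α, S = S1 ∪ S2 ∧ Disjoint S1 S2 ∧
      S1 ⊆ E1 ∧ S2 ⊆ E2 ∧ x = u1 S1 + u2 S2}.Finite := by
  refine ((S.powerset ×ˢ S.powerset).finite_toSet.image
    (fun p => u1 p.1 + u2 p.2)).subset ?_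
  rintro x ⟨S1, S2, rfl, -, -, -, rfl⟩
  exact ⟨(S1, S2), mem_coe.2 (mem_product.2 ⟨mem_powerset.2 subset_union_left,
    mem_powerset.2 subset_union_right⟩), rfl⟩

lemma le_mergeVal {E1 E2 : Finset α} (u1 u2 : Finset α → ℝ) {S1 S2 : Finset α}
    (hd : Disjoint S1 S2) (h1 : S1 ⊆ E1) (h2 : S2 ⊆ E2) :
    u1 S1 + u2 S2 ≤ mergeVal E1 E2 u1 u2 (S1 ∪ S2) :=
  le_csSup (mergeVal_set_finite E1 E2 u1 u2 _).bddAbove ⟨S1, S2, rfl, hd, h1, h2, rfl⟩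

lemma exists_mergeVal_eq {E1 E2 : Finset α} (u1 u2 : Finset α → ℝ) {S : Finset α}
    (hS : S ⊆ E1 ∪ E2) :
    ∃ S1 S2 : Finset α, S = S1 ∪ S2 ∧ Disjoint S1 S2 ∧ S1 ⊆ E1 ∧ S2 ⊆ E2 ∧
      mergeVal E1 E2 u1 u2 S = u1 S1 + u2 S2 := by
  refine Set.Nonempty.csSup_mem ?_ (mergeVal_set_finite E1 E2 u1 u2 S)
  refine ⟨_, S ∩ E1, S \ E1, by grind, ?_, by grind, by grind, rfl⟩
  rw [disjoint_left]
  grind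

lemma IsValuation.mergeVal {E1 E2 : Finset α} {u1 u2 : Finset α → ℝ}
    (h1 : IsValuation E1 u1) (h2 : IsValuation E2 u2) :
    IsValuation (E1 ∪ E2) (mergeVal E1 E2 u1 u2) := by
  refine ⟨?_, ?_, ?_⟩
  · obtain ⟨S1, S2, hS, -, -, -, h⟩ :=
      exists_mergeVal_eq (E1 := E1) (E2 := E2) u1 u2 (empty_subset _)
    obtain ⟨rfl, rfl⟩ := union_eq_empty.1 hS.symm
    rw [h, h1.1, h2.1, add_zero]
  · intro S hS
    obtain ⟨S1, S2, -, -, hS1, hS2, h⟩ := exists_mergeVal_eq u1 u2 hS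
    rw [h]
    exact add_nonneg (h1.2.1 _ hS1) (h2.2.1 _ hS2)
  · intro S T hST hT
    obtain ⟨S1, S2, rfl, hd, hS1, hS2, h⟩ := exists_mergeVal_eq u1 u2 (hST.trans hT)
    rw [h]
    have hT1 : S1 ∪ ((T \ (S1 ∪ S2)) ∩ E1) ⊆ E1 := by grind
    have hT2 : S2 ∪ ((T \ (S1 ∪ S2)) \ E1) ⊆ E2 := by grind
    have hdT : Disjoint (S1 ∪ ((T \ (S1 ∪ S2)) ∩ E1)) (S2 ∪ ((T \ (S1 ∪ S2)) \ E1)) := by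
      rw [disjoint_left] at hd ⊢
      grind
    have key := le_mergeVal u1 u2 hdT hT1 hT2
    have hTe : S1 ∪ ((T \ (S1 ∪ S2)) ∩ E1) ∪ (S2 ∪ ((T \ (S1 ∪ S2)) \ E1)) = T := by grind
    rw [hTe] at key
    exact (add_le_add (h1.2.2 subset_union_left hT1) (h2.2.2 subset_union_left hT2)).trans key

end Merge

section ValuatedMatroid

/-- The exchange property of M-concave functions on the `r`-subsets of `G`. -/
def MExchange (G : Finset α) (r : ℕ) (ω : Finset α → ℝ) : Prop :=
  ∀ ⦃B B' : Finset α⦄, B ⊆ G → B' ⊆ G → B.card = r → B'.card = r → ∀ i ∈ B \ B',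
    ∃ j ∈ B' \ B, ω B + ω B' ≤ ω (insert j (B.erase i)) + ω ((insert i B').erase j)

/-- The three-term exchange property on the `r`-subsets of `G`. -/
def ThreeTerm (G : Finset α) (r : ℕ) (ω : Finset α → ℝ) : Prop :=
  ∀ ⦃Z : Finset α⦄ ⦃i j k l : α⦄, Z ⊆ G → i ∈ G → j ∈ G → k ∈ G → l ∈ G →
    i ∉ Z → j ∉ Z → k ∉ Z → l ∉ Z → i ≠ j → i ≠ k → i ≠ l → j ≠ k → j ≠ l → k ≠ l →
    Z.card + 2 = r →
    ω (insert i (insert j Z)) + ω (insert k (insert l Z)) ≤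
        ω (insert i (insert k Z)) + ω (insert j (insert l Z)) ∨
      ω (insert i (insert j Z)) + ω (insert k (insert l Z)) ≤
        ω (insert i (insert l Z)) + ω (insert j (insert k Z))

lemma MExchange.threeTerm {G : Finset α} {r : ℕ} {ω : Finset α → ℝ} (h : MExchange G r ω) :
    ThreeTerm G r ω := by
  intro Z i j k l hZ hi hj hk hl hiZ hjZ hkZ hlZ hij hik hil hjk hjl hkl hr
  have hB : insert i (insert j Z) ⊆ G := by grind
  have hB' : insert k (insert l Z) ⊆ G := by grind
  have hc : (insert i (insert j Z)).card = r := by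
    rw [card_insert_of_notMem (by grind), card_insert_of_notMem hjZ]; omega
  have hc' : (insert k (insert l Z)).card = r := by
    rw [card_insert_of_notMem (by grind), card_insert_of_notMem hlZ]; omega
  obtain ⟨x, hx, h⟩ := h hB hB' hc hc' i (by grind)
  have hx' : x = k ∨ x = l := by grind
  rcases hx' with rfl | rfl
  · right
    have e1 : insert x ((insert i (insert j Z)).erase i) = insert j (insert x Z) := by grind
    have e2 : (insert i (insert x (insert l Z))).erase x = insert i (insert l Z) := by grind
    rw [e1, e2] at h
    linarith
  · left
    have e1 : insert x ((insert i (insert j Z)).erase i) = insert j (insert x Z) := by grind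
    have e2 : (insert i (insert k (insert x Z))).erase x = insert i (insert k Z) := by grind
    rw [e1, e2] at h
    linarith

lemma ThreeTerm.mExchange {G : Finset α} {r : ℕ} {ω : Finset α → ℝ} (h : ThreeTerm G r ω) :
    MExchange G r ω := by
  intro B B' hB hB' hc hc' i hi
  by_contra! hcon
  obtain ⟨hiB, hiB'⟩ := mem_sdiff.1 hi
  have main : ∀ N : ℕ, ∀ T : Finset α, T ⊆ G → T.card = r → i ∉ T → (B \ T).card ≤ N →
      ¬ ∀ v ∈ T \ B, ω (insert v (B.erase i)) + ω ((insert i T).erase v) < ω B + ω T := by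
    intro N
    induction N with
    | zero =>
      intro T _ _ hiT hN _
      have hBT : B \ T = ∅ := card_eq_zero.1 (Nat.le_zero.1 hN)
      exact hiT (sdiff_eq_empty_iff_subset.1 hBT hiB)
    | succ N ih =>
      intro T hT hcT hiT hN hV
      have hcard : (B \ T).card = (T \ B).card := by
        have h1 := card_sdiff_add_card_inter B T
        have h2 := card_sdiff_add_card_inter T B
        rw [inter_comm] at h2
        omega
      have hne : (T \ B).Nonempty := by
        rw [← card_pos, ← hcard, card_pos]
        exact ⟨i, mem_sdiff.2 ⟨hiB, hiT⟩⟩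
      by_cases ha : ∃ a ∈ B \ T, a ≠ i
      · obtain ⟨a, haBT, hai⟩ := ha
        obtain ⟨haB, haT⟩ := mem_sdiff.1 haBT
        obtain ⟨v₀, hv₀, hmax⟩ := exists_max_image (T \ B)
          (fun v => ω ((insert a T).erase v) + ω (insert v (B.erase i))) hne
        obtain ⟨hv₀T, hv₀B⟩ := mem_sdiff.1 hv₀
        have hva : v₀ ≠ a := fun h => haT (h ▸ hv₀T)
        have hvi : v₀ ≠ i := fun h => hiT (h ▸ hv₀T)
        have hBT : B \ ((insert a T).erase v₀) = (B \ T).erase a := by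
          clear * - hv₀B; grind
        refine ih ((insert a T).erase v₀)
          ((erase_subset _ _).trans (insert_subset (hB haB) hT)) ?_
          (by simp [hiT, hai.symm]) ?_ ?_
        · rw [card_erase_of_mem (mem_insert_of_mem hv₀T), card_insert_of_notMem haT]
          omega
        · rw [hBT, card_erase_of_mem haBT]
          omega
        · intro v hv
          obtain ⟨hvT', hvB⟩ := mem_sdiff.1 hv
          have hvv₀ : v ≠ v₀ := ne_of_mem_erase hvT'
          have hva' : v ≠ a := fun h => hvB (h ▸ haB)
          have hvT : v ∈ T := mem_of_mem_insert_of_ne (mem_of_mem_erase hvT') hva'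
          have hvi' : v ≠ i := fun h => hiT (h ▸ hvT)
          have hV1 := hV v (mem_sdiff.2 ⟨hvT, hvB⟩)
          have hV0 := hV v₀ hv₀
          have hm := hmax v (mem_sdiff.2 ⟨hvT, hvB⟩)
          have hcZ : ((T.erase v₀).erase v).card + 2 = r := by
            rw [card_erase_of_mem (mem_erase.2 ⟨hvv₀, hvT⟩), card_erase_of_mem hv₀T]
            have : 1 < T.card := one_lt_card.2 ⟨v, hvT, v₀, hv₀T, hvv₀⟩
            omega
          have h3 := h (Z := (T.erase v₀).erase v) (i := a) (j := i) (k := v₀) (l := v)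
            (((erase_subset _ _).trans (erase_subset _ _)).trans hT)
            (hB haB) (hB hiB) (hT hv₀T) (hT hvT) (by simp [haT]) (by simp [hiT]) (by simp)
            (by simp) hai hva.symm hva'.symm hvi.symm hvi'.symm hvv₀.symm hcZ
          obtain ⟨e1, e2, e3, e4, e5, e6⟩ :
              insert a (insert i ((T.erase v₀).erase v)) =
                (insert i ((insert a T).erase v₀)).erase v ∧
              insert v₀ (insert v ((T.erase v₀).erase v)) = T ∧
              insert a (insert v₀ ((T.erase v₀).erase v)) = (insert a T).erase v ∧
              insert i (insert v ((T.erase v₀).erase v)) = (insert i T).erase v₀ ∧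
              insert a (insert v ((T.erase v₀).erase v)) = (insert a T).erase v₀ ∧
              insert i (insert v₀ ((T.erase v₀).erase v)) = (insert i T).erase v := by
            clear * - hv₀T hvT hva hvi hva' hvi' hvv₀
            grind
          rw [e1, e2, e3, e4, e5, e6] at h3
          rcases h3 with h3 | h3 <;> linarith
      · push Not at ha
        have hBT : B \ T = {i} := by
          ext x
          simp only [mem_singleton]
          exact ⟨fun hx => ha x hx, fun hx => hx ▸ mem_sdiff.2 ⟨hiB, hiT⟩⟩
        obtain ⟨v, hv⟩ : ∃ v, T \ B = {v} := by
          rw [← card_eq_one, ← hcard, hBT, card_singleton]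
        have hvm : v ∈ T \ B := by simp [hv]
        have hV1 := hV v hvm
        have hB1 : ∀ x, x ∈ B → x ∉ T → x = i := fun x h1 h2 => ha x (mem_sdiff.2 ⟨h1, h2⟩)
        have hT1 : ∀ x, x ∈ T → x ∉ B → x = v := fun x h1 h2 => by
          have : x ∈ T \ B := mem_sdiff.2 ⟨h1, h2⟩
          simpa [hv] using this
        have e1 : insert v (B.erase i) = T := by
          ext x
          have := hB1 x
          have := hT1 x
          grind
        have e2 : (insert i T).erase v = B := by
          ext x
          have := hB1 x
          have := hT1 x
          grind
        rw [e1, e2] at hV1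
        linarith
  exact main _ B' hB' hc' hiB' le_rfl hcon

end ValuatedMatroid

section Aggregate

/-- Identify the element `e'` with `e`, choosing the better representative. -/
noncomputable def aggregate (e e' : α) (ω : Finset α → ℝ) (S : Finset α) : ℝ :=
  if e ∈ S then max (ω S) (ω (insert e' (S.erase e))) else ω S

variable {G W : Finset α} {r : ℕ} {ω : Finset α → ℝ} {e e' i j k l : α}

lemma MExchange.triple (h : MExchange G r ω) (hW : W ⊆ G) (hr : W.card + 3 = r)
    (hG : ∀ x ∈ [i, j, k, l, e, e'], x ∈ G ∧ x ∉ W) (hd : [i, j, k, l, e, e'].Nodup) :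
    let g := fun x y z => ω (insert x (insert y (insert z W)))
    g i j e + g k l e' ≤ g j k e + g i l e' ∨ g i j e + g k l e' ≤ g j l e + g i k e' ∨
      g i j e + g k l e' ≤ g j e e' + g i k l := by
  intro g
  simp only [List.nodup_cons, List.mem_cons, List.not_mem_nil, forall_eq_or_imp, not_or,
    or_false, forall_eq] at hG hd
  obtain ⟨⟨hi, hiW⟩, ⟨hj, hjW⟩, ⟨hk, hkW⟩, ⟨hl, hlW⟩, ⟨he, heW⟩, ⟨he', heW'⟩⟩ := hG
  obtain ⟨x, hx, h⟩ := h (B := insert i (insert j (insert e W)))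
    (B' := insert k (insert l (insert e' W)))
    (by simp [insert_subset_iff, *]) (by simp [insert_subset_iff, *])
    (by rw [card_insert_of_notMem, card_insert_of_notMem, card_insert_of_notMem] <;> grind)
    (by rw [card_insert_of_notMem, card_insert_of_notMem, card_insert_of_notMem] <;> grind) i
    (by grind)
  have e0 : (insert i (insert j (insert e W))).erase i = insert j (insert e W) :=
    erase_insert (by grind)
  rw [e0] at h
  have hx' : x = k ∨ x = l ∨ x = e' := by grind
  rcases hx' with rfl | rfl | rfl
  · left
    have e1 : insert x (insert j (insert e W)) = insert j (insert x (insert e W)) := insert_comm ..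
    have e2 : (insert i (insert x (insert l (insert e' W)))).erase x =
      insert i (insert l (insert e' W)) := by clear h; grind
    rwa [e1, e2] at h
  · right; left
    have e1 : insert x (insert j (insert e W)) = insert j (insert x (insert e W)) := insert_comm ..
    have e2 : (insert i (insert k (insert x (insert e' W)))).erase x =
      insert i (insert k (insert e' W)) := by clear h; grind
    rwa [e1, e2] at h
  · right; right
    have e1 : insert x (insert j (insert e W)) = insert j (insert e (insert x W)) := by
      clear h; grind
    have e2 : (insert i (insert k (insert l (insert x W)))).erase x =
      insert i (insert k (insert l W)) := by clear h; grind
    rwa [e1, e2] at h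

lemma ThreeTerm.triple_le_max (h : ThreeTerm G r ω) (hW : W ⊆ G) (hr : W.card + 3 = r)
    (hG : ∀ x ∈ [i, j, k, e, e'], x ∈ G ∧ x ∉ W) (hd : [i, j, k, e, e'].Nodup) :
    let g := fun x y z => ω (insert x (insert y (insert z W)))
    g i e e' + g i j k ≤ max (g i j e) (g i j e') + max (g i k e) (g i k e') := by
  intro g
  simp only [List.nodup_cons, List.mem_cons, List.not_mem_nil, forall_eq_or_imp, not_or,
    or_false, forall_eq] at hG hd
  obtain ⟨⟨hi, hiW⟩, ⟨hj, hjW⟩, ⟨hk, hkW⟩, ⟨he, heW⟩, ⟨he', heW'⟩⟩ := hG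
  have h := h (Z := insert i W) (i := e) (j := e') (k := j) (l := k)
    (by simp [insert_subset_iff, *]) he he' hj hk (by grind) (by grind) (by grind) (by grind)
    (by grind) (by grind) (by grind) (by grind) (by grind) (by grind)
    (by rw [card_insert_of_notMem hiW]; omega)
  have c : ∀ x y, insert x (insert y (insert i W)) = insert i (insert y (insert x W)) := by
    clear h; grind
  simp only [c] at h
  simp only [g]
  rw [insert_comm e e', insert_comm j k]
  rcases h with h | h
  · refine h.trans (add_le_add (le_max_left _ _) (le_max_right _ _))
  · refine h.trans ((add_comm _ _).trans_le (add_le_add (le_max_right _ _) (le_max_left _ _)))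

lemma MExchange.mixed (h : MExchange G r ω) (hW : W ⊆ G) (hr : W.card + 3 = r)
    (hG : ∀ x ∈ [i, j, k, l, e, e'], x ∈ G ∧ x ∉ W) (hd : [i, j, k, l, e, e'].Nodup) :
    let g := fun x y z => ω (insert x (insert y (insert z W)))
    let m := fun x y => max (g x y e) (g x y e')
    g i j e + g k l e' ≤ m i k + m j l ∨ g i j e + g k l e' ≤ m i l + m j k := by
  intro g m
  have g1 : ∀ x y z, g x y z = g y x z := fun x y z => by simp only [g]; rw [insert_comm]
  have g2 : ∀ x y z, g x y z = g x z y := fun x y z => by simp only [g]; rw [insert_comm y z]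
  have m1 : ∀ x y, m x y = m y x := fun x y => by simp only [m]; rw [g1 x y, g1 x y]
  have hl : ∀ x y, g x y e ≤ m x y := fun x y => le_max_left _ _
  have hr' : ∀ x y, g x y e' ≤ m x y := fun x y => le_max_right _ _
  have t1 := h.threeTerm.triple_le_max (i := i) (j := k) (k := l) (e := e) (e' := e') hW hr
    (fun x hx => hG x (by clear * - hx; grind)) (by clear * - hd; grind)
  have t2 := h.threeTerm.triple_le_max (i := j) (j := k) (k := l) (e := e) (e' := e') hW hr
    (fun x hx => hG x (by clear * - hx; grind)) (by clear * - hd; grind)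
  have t3 := h.threeTerm.triple_le_max (i := k) (j := i) (k := j) (e := e) (e' := e') hW hr
    (fun x hx => hG x (by clear * - hx; grind)) (by clear * - hd; grind)
  have t4 := h.threeTerm.triple_le_max (i := l) (j := i) (k := j) (e := e) (e' := e') hW hr
    (fun x hx => hG x (by clear * - hx; grind)) (by clear * - hd; grind)
  have s1 := h.triple hW hr hG hd
  have s2 := h.triple (i := j) (j := i) (k := k) (l := l) (e := e) (e' := e') hW hr
    (fun x hx => hG x (by clear * - hx; grind)) (by clear * - hd; grind)
  have s3 := h.triple (i := k) (j := l) (k := i) (l := j) (e := e') (e' := e) hW hr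
    (fun x hx => hG x (by clear * - hx; grind)) (by clear * - hd; grind)
  have s4 := h.triple (i := l) (j := k) (k := i) (l := j) (e := e') (e' := e) hW hr
    (fun x hx => hG x (by clear * - hx; grind)) (by clear * - hd; grind)
  change g i e e' + g i k l ≤ m i k + m i l at t1
  change g j e e' + g j k l ≤ m j k + m j l at t2
  change g k e e' + g k i j ≤ m k i + m k j at t3
  change g l e e' + g l i j ≤ m l i + m l j at t4
  by_contra! hcon
  obtain ⟨c1, c2⟩ := hcon
  change g i j e + g k l e' ≤ g j k e + g i l e' ∨ g i j e + g k l e' ≤ g j l e + g i k e' ∨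
      g i j e + g k l e' ≤ g j e e' + g i k l at s1
  change g j i e + g k l e' ≤ g i k e + g j l e' ∨ g j i e + g k l e' ≤ g i l e + g j k e' ∨
      g j i e + g k l e' ≤ g i e e' + g j k l at s2
  change g k l e' + g i j e ≤ g l i e' + g k j e ∨ g k l e' + g i j e ≤ g l j e' + g k i e ∨
      g k l e' + g i j e ≤ g l e' e + g k i j at s3
  change g l k e' + g i j e ≤ g k i e' + g l j e ∨ g l k e' + g i j e ≤ g k j e' + g l i e ∨
      g l k e' + g i j e ≤ g k e' e + g l i j at s4
  rw [g1 j i] at s2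
  rw [g2 l e' e, g1 l i, g1 k j, g1 l j, g1 k i e, g1 k i j] at s3
  rw [g2 k e' e, g1 l k, g1 k i, g1 l j, g1 k j, g1 l i, g1 l i] at s4
  rw [m1 k i, m1 k j, g1 k i] at t3
  rw [m1 l i, m1 l j, g1 l i] at t4
  have a1 := hl j k; have a2 := hl j l; have a3 := hl i k; have a4 := hl i l
  have b1 := hr' j k; have b2 := hr' j l; have b3 := hr' i k; have b4 := hr' i l
  have u1 : g i j e + g k l e' ≤ g j e e' + g i k l := by
    rcases s1 with s | s | s <;> linarith
  have u2 : g i j e + g k l e' ≤ g i e e' + g j k l := by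
    rcases s2 with s | s | s <;> linarith
  have u3 : g i j e + g k l e' ≤ g l e e' + g i k j := by
    rcases s3 with s | s | s <;> linarith
  have u4 : g i j e + g k l e' ≤ g k e e' + g i l j := by
    rcases s4 with s | s | s <;> linarith
  linarith

lemma aggregate_of_notMem {S : Finset α} (he : e ∉ S) : aggregate e e' ω S = ω S := if_neg he

lemma aggregate_insert {S : Finset α} (he : e ∉ S) :
    aggregate e e' ω (insert e S) = max (ω (insert e S)) (ω (insert e' S)) := by
  rw [aggregate, if_pos (mem_insert_self _ _), erase_insert he]

lemma ThreeTerm.aggregate_left (h : ThreeTerm G r ω) (hW : W ⊆ G)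
    (hG : ∀ x ∈ [e, e', j, k, l], x ∈ G ∧ x ∉ W) (hd : [e, e', j, k, l].Nodup)
    (hr : W.card + 2 = r) :
    let f := fun x y => aggregate e e' ω (insert x (insert y W))
    f e j + f k l ≤ f e k + f j l ∨ f e j + f k l ≤ f e l + f j k := by
  intro f
  simp only [List.nodup_cons, List.mem_cons, List.not_mem_nil, forall_eq_or_imp, not_or,
    or_false, forall_eq] at hG hd
  obtain ⟨⟨he, heW⟩, ⟨he', heW'⟩, ⟨hj, hjW⟩, ⟨hk, hkW⟩, ⟨hl, hlW⟩⟩ := hG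
  obtain ⟨⟨hee', hej, hek, hel⟩, ⟨hej', hek', hel'⟩, ⟨hjk, hjl⟩, hkl, -⟩ := hd
  have f1 : ∀ x ∈ [j, k, l], f e x = max (ω (insert e (insert x W))) (ω (insert e' (insert x W))) :=
    fun x hx => aggregate_insert (by grind)
  have f2 : ∀ x ∈ [j, k, l], ∀ y ∈ [j, k, l], f x y = ω (insert x (insert y W)) :=
    fun x hx y hy => aggregate_of_notMem (by grind)
  rw [f1 j (by simp), f1 k (by simp), f1 l (by simp), f2 k (by simp) l (by simp),
    f2 j (by simp) l (by simp), f2 j (by simp) k (by simp)]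
  clear f1 f2 f
  have h1 := h hW he hj hk hl heW hjW hkW hlW hej hek hel hjk hjl hkl hr
  have h2 := h hW he' hj hk hl heW' hjW hkW hlW hej' hek' hel' hjk hjl hkl hr
  rcases max_choice (ω (insert e (insert j W))) (ω (insert e' (insert j W))) with hm | hm <;>
    rw [hm]
  · exact h1.imp (fun h => h.trans (by gcongr; exact le_max_left _ _))
      (fun h => h.trans (by gcongr; exact le_max_left _ _))
  · exact h2.imp (fun h => h.trans (by gcongr; exact le_max_right _ _))
      (fun h => h.trans (by gcongr; exact le_max_right _ _))

lemma MExchange.aggregate_mem (h : MExchange G r ω) (hW : W ⊆ G) (hr : W.card + 3 = r)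
    (hG : ∀ x ∈ [i, j, k, l, e, e'], x ∈ G ∧ x ∉ W) (hd : [i, j, k, l, e, e'].Nodup) :
    let m := fun x y =>
      max (ω (insert x (insert y (insert e W)))) (ω (insert x (insert y (insert e' W))))
    m i j + m k l ≤ m i k + m j l ∨ m i j + m k l ≤ m i l + m j k := by
  intro m
  have h1 := h.mixed hW hr hG hd
  have h2 := h.mixed (i := i) (j := j) (k := k) (l := l) (e := e') (e' := e) hW hr
    (fun x hx => hG x (by clear * - hx; grind)) (by clear * - hd; grind)
  simp only [max_comm (ω (insert _ (insert _ (insert e' _))))] at h2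
  simp only [List.nodup_cons, List.mem_cons, List.not_mem_nil, forall_eq_or_imp, not_or,
    or_false, forall_eq] at hG hd
  obtain ⟨⟨hi, hiW⟩, ⟨hj, hjW⟩, ⟨hk, hkW⟩, ⟨hl, hlW⟩, ⟨he, heW⟩, ⟨he', heW'⟩⟩ := hG
  obtain ⟨⟨hij, hik, hil, hie, hie'⟩, ⟨hjk, hjl, hje, hje'⟩, ⟨hkl, hke, hke'⟩, ⟨hle, hle'⟩,
    hee', -⟩ := hd
  have key : ∀ y ∈ [e, e'],
      ω (insert i (insert j (insert y W))) + ω (insert k (insert l (insert y W))) ≤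
        ω (insert i (insert k (insert y W))) + ω (insert j (insert l (insert y W))) ∨
      ω (insert i (insert j (insert y W))) + ω (insert k (insert l (insert y W))) ≤
        ω (insert i (insert l (insert y W))) + ω (insert j (insert k (insert y W))) := by
    intro y hy
    have hy' : y ∈ G ∧ y ∉ W ∧ i ≠ y ∧ j ≠ y ∧ k ≠ y ∧ l ≠ y := by
      clear h h1 h2; grind
    obtain ⟨hyG, hyW, hiy, hjy, hky, hly⟩ := hy'
    exact h.threeTerm (Z := insert y W) (insert_subset hyG hW) hi hj hk hl
      (by simp [*]) (by simp [*]) (by simp [*]) (by simp [*]) hij hik hil hjk hjl hkl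
      (by rw [card_insert_of_notMem hyW]; omega)
  have l1 : ∀ x y, ω (insert x (insert y (insert e W))) ≤ m x y := fun x y => le_max_left _ _
  have l2 : ∀ x y, ω (insert x (insert y (insert e' W))) ≤ m x y := fun x y => le_max_right _ _
  have k1 := key e (by simp)
  have k2 := key e' (by simp)
  have c1 : m i j = _ ∨ m i j = _ := max_choice _ _
  have c2 : m k l = _ ∨ m k l = _ := max_choice _ _
  rcases c1 with c1 | c1 <;> rcases c2 with c2 | c2 <;> rw [c1, c2]
  · exact k1.imp (fun h => h.trans (add_le_add (l1 _ _) (l1 _ _)))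
      (fun h => h.trans (add_le_add (l1 _ _) (l1 _ _)))
  · exact h1
  · exact h2
  · exact k2.imp (fun h => h.trans (add_le_add (l2 _ _) (l2 _ _)))
      (fun h => h.trans (add_le_add (l2 _ _) (l2 _ _)))

/-- Identifying two elements preserves M-concavity. -/
lemma mExchange_aggregate (h : MExchange G r ω) (he : e ∈ G) (he' : e' ∈ G) (hne : e ≠ e') :
    MExchange (G.erase e') r (aggregate e e' ω) := by
  refine ThreeTerm.mExchange ?_
  intro Z i j k l hZ hi hj hk hl hiZ hjZ hkZ hlZ hij hik hil hjk hjl hkl hr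
  have hZG : Z ⊆ G := hZ.trans (erase_subset _ _)
  have heZ' : e' ∉ Z := fun h => (mem_erase.1 (hZ h)).1 rfl
  rw [mem_erase] at hi hj hk hl
  by_cases heZ : e ∈ Z
  · obtain ⟨W, heW, rfl⟩ : ∃ W, e ∉ W ∧ Z = insert e W :=
      ⟨Z.erase e, notMem_erase _ _, (insert_erase heZ).symm⟩
    have agg : ∀ x y, x ≠ e → y ≠ e → aggregate e e' ω (insert x (insert y (insert e W))) =
        max (ω (insert x (insert y (insert e W)))) (ω (insert x (insert y (insert e' W)))) := by
      intro x y hx hy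
      have c : ∀ z, insert x (insert y (insert z W)) = insert z (insert x (insert y W)) := by
        clear * -; grind
      rw [c e, c e', aggregate_insert (by simp [hx.symm, hy.symm, heW])]
    simp only [mem_insert, not_or] at hiZ hjZ hkZ hlZ heZ'
    rw [agg _ _ hiZ.1 hjZ.1, agg _ _ hkZ.1 hlZ.1, agg _ _ hiZ.1 hkZ.1, agg _ _ hjZ.1 hlZ.1,
      agg _ _ hiZ.1 hlZ.1, agg _ _ hjZ.1 hkZ.1]
    rw [card_insert_of_notMem heW] at hr
    refine h.aggregate_mem ((subset_insert _ _).trans hZG) (by omega) ?_ ?_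
    · clear agg; simp [*]
    · clear agg; simp [*]
  by_cases h1 : e = i
  · subst h1
    exact h.threeTerm.aggregate_left hZG (by simp [*]) (by simp [*]; tauto) hr
  by_cases h2 : e = j
  · subst h2
    have := h.threeTerm.aggregate_left (e := e) (e' := e') (j := i) (k := k) (l := l)
      hZG (by simp [*]) (by simp [*]; tauto) hr
    rw [insert_comm i e]
    rcases this with t | t <;> beta_reduce at t
    · right; linarith
    · left; linarith
  by_cases h3 : e = k
  · subst h3
    have := h.threeTerm.aggregate_left (e := e) (e' := e') (j := l) (k := i) (l := j)
      hZG (by simp [*]) (by simp [*]; tauto) hr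
    rw [insert_comm i e, insert_comm j e, insert_comm j l, insert_comm i l]
    rcases this with t | t <;> beta_reduce at t
    · left; linarith
    · right; linarith
  by_cases h4 : e = l
  · subst h4
    have := h.threeTerm.aggregate_left (e := e) (e' := e') (j := k) (k := i) (l := j)
      hZG (by simp [*]) (by simp [*]; tauto) hr
    rw [insert_comm k e, insert_comm j e, insert_comm i e, insert_comm i k, insert_comm j k]
    rcases this with t | t <;> beta_reduce at t
    · right; linarith
    · left; linarith
  have agg : ∀ x y, e ≠ x → e ≠ y → aggregate e e' ω (insert x (insert y Z)) =
      ω (insert x (insert y Z)) := fun x y hx hy => aggregate_of_notMem (by simp [hx, hy, heZ])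
  rw [agg _ _ h1 h2, agg _ _ h3 h4, agg _ _ h1 h3, agg _ _ h2 h4, agg _ _ h1 h4, agg _ _ h2 h3]
  exact h.threeTerm hZG hi.2 hj.2 hk.2 hl.2 hiZ hjZ hkZ hlZ hij hik hil hjk hjl hkl hr

end Aggregate

section Homogenization

/-- The M♮-exchange property on subsets of `E`. -/
def MNatExchange (E : Finset α) (u : Finset α → ℝ) : Prop :=
  ∀ ⦃S T : Finset α⦄, S ⊆ E → T ⊆ E → ∀ i ∈ S \ T,
    u S + u T ≤ u (S.erase i) + u (insert i T) ∨
      ∃ j ∈ T \ S, u S + u T ≤ u (insert j (S.erase i)) + u ((insert i T).erase j)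

variable {E W : Finset α} {u : Finset α → ℝ} {i j k l : α}

lemma MNatExchange.submodular (h : MNatExchange E u) (hW : W ⊆ E) (hi : i ∈ E) (hj : j ∈ E)
    (hiW : i ∉ W) (hij : i ≠ j) :
    u (insert i (insert j W)) + u W ≤ u (insert i W) + u (insert j W) := by
  rcases h (S := insert i (insert j W)) (T := W) (by grind) hW i (by grind) with h | ⟨x, hx, -⟩
  · rw [erase_insert (by grind)] at h
    linarith
  · grind

lemma MNatExchange.threeTerm_one_dummy (h : MNatExchange E u) (hW : W ⊆ E) (hi : i ∈ E)
    (hj : j ∈ E) (hk : k ∈ E) (hiW : i ∉ W) (hkW : k ∉ W)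
    (hij : i ≠ j) (hik : i ≠ k) (hjk : j ≠ k) :
    u (insert i (insert j W)) + u (insert k W) ≤ u (insert i (insert k W)) + u (insert j W) ∨
      u (insert i (insert j W)) + u (insert k W) ≤ u (insert i W) + u (insert j (insert k W)) := by
  rcases h (S := insert i (insert j W)) (T := insert k W) (by grind) (by grind) i (by grind)
    with h | ⟨x, hx, h⟩ <;> rw [erase_insert (by grind)] at h
  · left; linarith
  · right
    obtain rfl : x = k := by clear h; grind
    have e1 : (insert i (insert x W)).erase x = insert i W := by clear h; grind
    rw [e1, insert_comm x j] at h
    linarith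

lemma MNatExchange.null_or_threeTerm (h : MNatExchange E u) (hW : W ⊆ E) (hi : i ∈ E) (hj : j ∈ E)
    (hk : k ∈ E) (hl : l ∈ E) (hiW : i ∉ W) (hkW : k ∉ W) (hlW : l ∉ W)
    (hij : i ≠ j) (hik : i ≠ k) (hil : i ≠ l) (hjk : j ≠ k) (hjl : j ≠ l) (hkl : k ≠ l) :
    let f := fun x y => u (insert x (insert y W))
    f i j + f k l ≤ u (insert j W) + u (insert i (insert k (insert l W))) ∨
      f i j + f k l ≤ f i k + f j l ∨ f i j + f k l ≤ f i l + f j k := by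
  intro f
  rcases h (S := insert i (insert j W)) (T := insert k (insert l W)) (by grind) (by grind) i
    (by grind) with h | ⟨x, hx, h⟩ <;> rw [erase_insert (by grind)] at h
  · left; exact h
  · have hx' : x = k ∨ x = l := by clear h; grind
    rcases hx' with rfl | rfl
    · right; right
      have e1 : (insert i (insert x (insert l W))).erase x = insert i (insert l W) := by
        clear h; grind
      rw [e1, insert_comm x j] at h
      simp only [f]; linarith
    · right; left
      have e1 : (insert i (insert k (insert x W))).erase x = insert i (insert k W) := by
        clear h; grind
      rw [e1, insert_comm x j] at h
      simp only [f]; linarith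

lemma MNatExchange.threeTerm (h : MNatExchange E u) (hW : W ⊆ E) (hi : i ∈ E) (hj : j ∈ E)
    (hk : k ∈ E) (hl : l ∈ E) (hiW : i ∉ W) (hjW : j ∉ W) (hkW : k ∉ W) (hlW : l ∉ W)
    (hij : i ≠ j) (hik : i ≠ k) (hil : i ≠ l) (hjk : j ≠ k) (hjl : j ≠ l) (hkl : k ≠ l) :
    let f := fun x y => u (insert x (insert y W))
    f i j + f k l ≤ f i k + f j l ∨ f i j + f k l ≤ f i l + f j k := by
  intro f
  have sub : ∀ x y z, x ∈ [i, j, k, l] → y ∈ [i, j, k, l] → z ∈ [i, j, k, l] → x ≠ y → x ≠ z →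
      y ≠ z → u (insert x (insert y (insert z W))) + u (insert x W) ≤ f x y + f x z := by
    intro x y z hx hy hz hxy hxz hyz
    have hm : ∀ x ∈ [i, j, k, l], x ∈ E ∧ x ∉ W := by simp [*]
    have := h.submodular (W := insert x W) (i := y) (j := z) (insert_subset (hm x hx).1 hW)
      (hm y hy).1 (hm z hz).1 (by simp [hm y hy, hxy.symm]) hyz
    have e1 : insert x (insert y (insert z W)) = insert y (insert z (insert x W)) := by
      clear * -; grind
    simp only [f]
    rwa [e1, insert_comm x y, insert_comm x z]
  have comm : ∀ x y, f x y = f y x := fun x y => by simp only [f]; rw [insert_comm]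
  have n1 := h.null_or_threeTerm hW hi hj hk hl hiW hkW hlW hij hik hil hjk hjl hkl
  have n2 := h.null_or_threeTerm hW hj hi hk hl hjW hkW hlW hij.symm hjk hjl hik hil hkl
  have n3 := h.null_or_threeTerm hW hk hl hi hj hkW hiW hjW hkl hik.symm hjk.symm hil.symm
    hjl.symm hij
  have n4 := h.null_or_threeTerm hW hl hk hi hj hlW hiW hjW hkl.symm hil.symm hjl.symm hik.symm
    hjk.symm hij
  have s1 := sub i k l (by simp) (by simp) (by simp) hik hil hkl
  have s2 := sub j k l (by simp) (by simp) (by simp) hjk hjl hkl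
  have s3 := sub k i j (by simp) (by simp) (by simp) hik.symm hjk.symm hij
  have s4 := sub l i j (by simp) (by simp) (by simp) hil.symm hjl.symm hij
  change f i j + f k l ≤ _ ∨ f i j + f k l ≤ f i k + f j l ∨ f i j + f k l ≤ f i l + f j k at n1
  change f j i + f k l ≤ _ ∨ f j i + f k l ≤ f j k + f i l ∨ f j i + f k l ≤ f j l + f i k at n2
  change f k l + f i j ≤ _ ∨ f k l + f i j ≤ f k i + f l j ∨ f k l + f i j ≤ f k j + f l i at n3
  change f l k + f i j ≤ _ ∨ f l k + f i j ≤ f l i + f k j ∨ f l k + f i j ≤ f l j + f k i at n4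
  rw [comm j i] at n2
  rw [comm k i, comm l j, comm k j, comm l i] at n3
  rw [comm l k, comm k i, comm l j, comm k j, comm l i] at n4
  rw [comm k i, comm k j] at s3
  rw [comm l i, comm l j] at s4
  by_contra! hcon
  obtain ⟨c1, c2⟩ := hcon
  have u1 := n1.resolve_right (by rintro (h | h) <;> linarith)
  have u2 := n2.resolve_right (by rintro (h | h) <;> linarith)
  have u3 := n3.resolve_right (by rintro (h | h) <;> linarith)
  have u4 := n4.resolve_right (by rintro (h | h) <;> linarith)
  linarith

/-- Padding with dummy elements turns an M♮-concave function into an M-concave one. -/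
lemma MNatExchange.mExchange_toLeft (h : MNatExchange E u) (D : Finset ℕ) (r : ℕ) :
    MExchange (E.disjSum D) r (fun B => u B.toLeft) := by
  refine ThreeTerm.mExchange ?_
  intro Z i j k l hZ hi hj hk hl hiZ hjZ hkZ hlZ hij hik hil hjk hjl hkl _
  have hW : Z.toLeft ⊆ E := by
    intro x hx
    have := hZ (mem_toLeft.1 hx)
    simpa using this
  beta_reduce
  rcases i with i | i <;> rcases j with j | j <;> rcases k with k | k <;> rcases l with l | l <;>
    simp only [toLeft_insert_inl, toLeft_insert_inr, toLeft_disjSum, ne_eq, Sum.inl.injEq,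
      ← mem_toLeft] at *
  · exact h.threeTerm hW hi hj hk hl hiZ hjZ hkZ hlZ hij hik hil hjk hjl hkl
  · exact h.threeTerm_one_dummy hW hi hj hk hiZ hkZ hij hik hjk
  · exact (h.threeTerm_one_dummy hW hi hj hl hiZ hlZ hij hil hjl).symm
  · exact .inl (h.submodular hW hi hj hiZ hij)
  · have := h.threeTerm_one_dummy hW hk hl hi hkZ hiZ hkl (Ne.symm hik) (Ne.symm hil)
    rw [insert_comm k i, insert_comm l i] at this
    exact this.imp (fun t => by linarith) (fun t => by linarith)
  · exact .inr le_rfl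
  · exact .inl le_rfl
  · exact .inl le_rfl
  · have := h.threeTerm_one_dummy hW hk hl hj hkZ hjZ hkl (Ne.symm hjk) (Ne.symm hjl)
    rw [insert_comm k j, insert_comm l j] at this
    exact this.symm.imp (fun t => by linarith) (fun t => by linarith)
  · exact .inl (add_comm _ _).le
  · exact .inr (add_comm _ _).le
  · exact .inl (add_comm _ _).le
  · exact .inl ((add_comm _ _).trans_le (h.submodular hW hk hl hkZ hkl))
  · exact .inl (add_comm _ _).le
  · exact .inl le_rfl
  · exact .inl le_rfl

end Homogenization

section DirectSum

variable {β : Type*} [DecidableEq β]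

lemma toLeft_erase_inl (B : Finset (α ⊕ β)) (x : α) :
    (B.erase (.inl x)).toLeft = B.toLeft.erase x := by ext; simp

lemma toLeft_erase_inr (B : Finset (α ⊕ β)) (x : β) :
    (B.erase (.inr x)).toLeft = B.toLeft := by ext; simp

lemma toRight_erase_inl (B : Finset (α ⊕ β)) (x : α) :
    (B.erase (.inl x)).toRight = B.toRight := by ext; simp

lemma toRight_erase_inr (B : Finset (α ⊕ β)) (x : β) :
    (B.erase (.inr x)).toRight = B.toRight.erase x := by ext; simp

lemma MNatExchange.disjSum {E1 : Finset α} {E2 : Finset β} {u1 : Finset α → ℝ}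
    {u2 : Finset β → ℝ} (h1 : MNatExchange E1 u1) (h2 : MNatExchange E2 u2) :
    MNatExchange (E1.disjSum E2) (fun B => u1 B.toLeft + u2 B.toRight) := by
  intro S T hS hT i hi
  rw [subset_disjSum] at hS hT
  rcases i with i | i
  · have hi' : i ∈ S.toLeft \ T.toLeft := by simpa using hi
    rcases h1 hS.1 hT.1 i hi' with h | ⟨j, hj, h⟩
    · left
      simp only [toLeft_erase_inl, toRight_erase_inl, toLeft_insert_inl, toRight_insert_inl]
      linarith
    · refine .inr ⟨.inl j, by simpa using hj, ?_⟩
      simp only [toLeft_erase_inl, toRight_erase_inl, toLeft_insert_inl, toRight_insert_inl]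
      linarith
  · have hi' : i ∈ S.toRight \ T.toRight := by simpa using hi
    rcases h2 hS.2 hT.2 i hi' with h | ⟨j, hj, h⟩
    · left
      simp only [toLeft_erase_inr, toRight_erase_inr, toLeft_insert_inr, toRight_insert_inr]
      linarith
    · refine .inr ⟨.inr j, by simpa using hj, ?_⟩
      simp only [toLeft_erase_inr, toRight_erase_inr, toLeft_insert_inr, toRight_insert_inr]
      linarith

end DirectSum

section MergeExchange

variable {E1 E2 : Finset α} {u1 u2 : Finset α → ℝ}

lemma MNatExchange.exists_aggregate (h1 : MNatExchange E1 u1) (h2 : MNatExchange E2 u2)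
    (D : Finset ℕ) (r : ℕ) {F : Finset α} (hF : F ⊆ E1 ∩ E2) :
    ∃ ω : Finset ((α ⊕ α) ⊕ ℕ) → ℝ, MExchange ((E1.disjSum (E2 \ F)).disjSum D) r ω ∧
      ∀ B ⊆ (E1.disjSum (E2 \ F)).disjSum D,
        (∀ C ⊆ F, C ⊆ B.toLeft.toLeft →
          u1 (B.toLeft.toLeft \ C) + u2 (B.toLeft.toRight ∪ C) ≤ ω B) ∧
        ∃ C ⊆ F, C ⊆ B.toLeft.toLeft ∧
          ω B = u1 (B.toLeft.toLeft \ C) + u2 (B.toLeft.toRight ∪ C) := by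
  induction F using Finset.induction_on with
  | empty =>
    refine ⟨fun B => u1 B.toLeft.toLeft + u2 B.toLeft.toRight, ?_, ?_⟩
    · rw [sdiff_empty]
      exact (h1.disjSum h2).mExchange_toLeft D r
    · intro B _
      refine ⟨fun C hC _ => ?_, ∅, subset_rfl, empty_subset _, by simp⟩
      simp [subset_empty.1 hC]
  | insert x F hx ih =>
    obtain ⟨ω, hω, hspec⟩ := ih ((subset_insert _ _).trans hF)
    have hxE := mem_inter.1 (hF (mem_insert_self x F))
    have hG : (E1.disjSum (E2 \ insert x F)).disjSum D =
        ((E1.disjSum (E2 \ F)).disjSum D).erase (.inl (.inr x)) := by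
      ext ((y | y) | y) <;> simp
      grind
    refine ⟨aggregate (.inl (.inl x)) (.inl (.inr x)) ω, ?_, ?_⟩
    · rw [hG]
      exact mExchange_aggregate hω (by simp [hxE]) (by simp [hxE, hx]) (by simp)
    · intro B hB
      rw [hG] at hB
      have hBG := hB.trans (erase_subset _ _)
      by_cases hxB : Sum.inl (Sum.inl x) ∈ B
      · have hxL : x ∈ B.toLeft.toLeft := by simpa using hxB
        have hB'G : insert (.inl (.inr x)) (B.erase (.inl (.inl x))) ⊆
            (E1.disjSum (E2 \ F)).disjSum D :=
          insert_subset (by simp [hxE, hx]) ((erase_subset _ _).trans hBG)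
        have s1 := hspec B hBG
        have s2 := hspec _ hB'G
        simp only [toLeft_insert_inl, toLeft_erase_inl, toLeft_insert_inr, toRight_insert_inr,
          toRight_erase_inl] at s2
        rw [aggregate, if_pos hxB]
        have e1 : ∀ C : Finset α, (B.toLeft.toLeft).erase x \ C = B.toLeft.toLeft \ insert x C := by
          intro C; ext; simp; tauto
        have e2 : ∀ C : Finset α,
            insert x B.toLeft.toRight ∪ C = B.toLeft.toRight ∪ insert x C := by
          intro C; ext; simp
        simp only [e1, e2] at s2
        refine ⟨fun C hC hCB => ?_, ?_⟩
        · by_cases hxC : x ∈ C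
          · have := s2.1 (C.erase x) (by grind) (by grind)
            rw [insert_erase hxC] at this
            exact this.trans (le_max_right _ _)
          · exact (s1.1 C ((subset_insert_iff_of_notMem hxC).1 hC) hCB).trans (le_max_left _ _)
        · rcases max_choice (ω B) (ω (insert (.inl (.inr x)) (B.erase (.inl (.inl x))))) with h | h
          · obtain ⟨C, hC, hCB, hv⟩ := s1.2
            exact ⟨C, hC.trans (subset_insert _ _), hCB, h.trans hv⟩
          · obtain ⟨C, hC, hCB, hv⟩ := s2.2
            exact ⟨insert x C, insert_subset_insert _ hC,
              insert_subset hxL (hCB.trans (erase_subset _ _)), h.trans hv⟩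
      · rw [aggregate_of_notMem hxB]
        obtain ⟨s1, C, hC, s2⟩ := hspec B hBG
        refine ⟨fun C hC hCB => s1 C ?_ hCB, C, hC.trans (subset_insert _ _), s2⟩
        refine (subset_insert_iff_of_notMem fun hxC => hxB ?_).1 hC
        simpa using hCB hxC

/-- The set of elements of `α` represented by a set in the disjoint sum. -/
def foldSum (B : Finset ((α ⊕ α) ⊕ ℕ)) : Finset α := B.toLeft.toLeft ∪ B.toLeft.toRight

lemma mem_foldSum {B : Finset ((α ⊕ α) ⊕ ℕ)} {x : α} :
    x ∈ foldSum B ↔ Sum.inl (Sum.inl x) ∈ B ∨ Sum.inl (Sum.inr x) ∈ B := by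
  simp [foldSum]

lemma MNatExchange.exists_mExchange_foldSum (h1 : MNatExchange E1 u1) (h2 : MNatExchange E2 u2)
    (D : Finset ℕ) (r : ℕ) :
    ∃ ω : Finset ((α ⊕ α) ⊕ ℕ) → ℝ, MExchange ((E1.disjSum (E2 \ E1)).disjSum D) r ω ∧
      ∀ B ⊆ (E1.disjSum (E2 \ E1)).disjSum D, ω B = mergeVal E1 E2 u1 u2 (foldSum B) := by
  obtain ⟨ω, hω, hspec⟩ := h1.exists_aggregate h2 D r (subset_refl (E1 ∩ E2))
  have hE : E2 \ (E1 ∩ E2) = E2 \ E1 := by ext; simp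
  rw [hE] at hω hspec
  refine ⟨ω, hω, fun B hB => ?_⟩
  obtain ⟨hle, C, hC, hCB, hv⟩ := hspec B hB
  rw [subset_disjSum, subset_disjSum] at hB
  obtain ⟨⟨hL, hR⟩, -⟩ := hB
  have hC2 : C ⊆ E2 := hC.trans inter_subset_right
  have hR2 : B.toLeft.toRight ⊆ E2 := hR.trans sdiff_subset
  unfold foldSum
  generalize B.toLeft.toLeft = L at *
  generalize B.toLeft.toRight = R at *
  apply le_antisymm
  · rw [hv]
    have hu : L ∪ R = (L \ C) ∪ (R ∪ C) := by grind
    have hd : Disjoint (L \ C) (R ∪ C) := by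
      rw [disjoint_left]
      grind
    rw [hu]
    exact le_mergeVal u1 u2 hd (sdiff_subset.trans hL) (union_subset hR2 hC2)
  · obtain ⟨S1, S2, hu, hd, hS1, hS2, h⟩ :=
      exists_mergeVal_eq u1 u2 (union_subset_union hL hR2)
    rw [disjoint_left] at hd
    have hm : ∀ x, x ∈ L ∨ x ∈ R ↔ x ∈ S1 ∨ x ∈ S2 := by
      intro x; rw [← mem_union, hu, mem_union]
    have := hle (S2 ∩ E1) (by grind) (by grind)
    have e1 : L \ (S2 ∩ E1) = S1 := by
      ext x; have := hm x; clear hle hv h this; grind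
    have e2 : R ∪ S2 ∩ E1 = S2 := by
      ext x; have := hm x; clear hle hv h this; grind
    rwa [e1, e2, ← h] at this

end MergeExchange

section TagSum

variable {E1 E2 S : Finset α} {u1 u2 : Finset α → ℝ}

/-- The representative of `x` in the disjoint sum. -/
def tagSum (E1 : Finset α) (x : α) : (α ⊕ α) ⊕ ℕ :=
  if x ∈ E1 then .inl (.inl x) else .inl (.inr x)

lemma tagSum_inj {x y : α} : tagSum E1 x = tagSum E1 y ↔ x = y := by
  unfold tagSum
  split_ifs <;> simp <;> rintro rfl <;> contradiction

lemma tagSum_ne_inr {x : α} {d : ℕ} : tagSum E1 x ≠ .inr d := by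
  unfold tagSum
  split_ifs <;> simp

lemma tagSum_mem {D : Finset ℕ} {x : α} :
    tagSum E1 x ∈ (E1.disjSum (E2 \ E1)).disjSum D ↔ x ∈ E1 ∪ E2 := by
  unfold tagSum
  split_ifs with h <;> simp [h]

lemma mem_foldSum_iff {D : Finset ℕ} {B : Finset ((α ⊕ α) ⊕ ℕ)}
    (hB : B ⊆ (E1.disjSum (E2 \ E1)).disjSum D) {x : α} :
    x ∈ foldSum B ↔ tagSum E1 x ∈ B := by
  have h1 := @hB (.inl (.inl x))
  have h2 := @hB (.inl (.inr x))
  simp only [inl_mem_disjSum, inr_mem_disjSum, mem_sdiff] at h1 h2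
  rw [mem_foldSum, tagSum]
  split_ifs <;> tauto

/-- The set in the disjoint sum that represents `S`, padded with `d` dummy elements. -/
def embedSum (E1 S : Finset α) (d : ℕ) : Finset ((α ⊕ α) ⊕ ℕ) :=
  ((S ∩ E1).disjSum (S \ E1)).disjSum (range d)

lemma foldSum_embedSum (d : ℕ) : foldSum (embedSum E1 S d) = S := by
  ext x
  simp only [mem_foldSum, embedSum, inl_mem_disjSum, inr_mem_disjSum, mem_inter, mem_sdiff]
  tauto

lemma card_embedSum (d : ℕ) : (embedSum E1 S d).card = S.card + d := by
  rw [embedSum, card_disjSum, card_disjSum, card_range, card_inter_add_card_sdiff]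

lemma tagSum_mem_embedSum {d : ℕ} {x : α} : tagSum E1 x ∈ embedSum E1 S d ↔ x ∈ S := by
  unfold tagSum embedSum
  split_ifs with h <;> simp [h]

/-- The M♮-exchange property is preserved by merging. -/
lemma MNatExchange.mergeVal (h1 : MNatExchange E1 u1) (h2 : MNatExchange E2 u2) :
    MNatExchange (E1 ∪ E2) (mergeVal E1 E2 u1 u2) := by
  intro S T hS hT i hi
  obtain ⟨hiS, hiT⟩ := mem_sdiff.1 hi
  set N := (E1 ∪ E2).card
  obtain ⟨ω, hω, hval⟩ := h1.exists_mExchange_foldSum h2 (range N) N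
  set Γ := (E1.disjSum (E2 \ E1)).disjSum (range N)
  have hG : ∀ S ⊆ E1 ∪ E2, embedSum E1 S (N - S.card) ⊆ Γ := by
    intro S hS
    exact disjSum_mono (disjSum_mono inter_subset_right (by grind))
      (range_mono (Nat.sub_le _ _))
  have hc : ∀ S ⊆ E1 ∪ E2, (embedSum E1 S (N - S.card)).card = N := by
    intro S hS
    have := card_le_card hS
    rw [card_embedSum]
    omega
  have hBG := hG S hS
  have hBG' := hG T hT
  have hiG : tagSum E1 i ∈ Γ := tagSum_mem.2 (hS hiS)
  obtain ⟨j, hj, h⟩ := hω hBG hBG' (hc S hS) (hc T hT) (tagSum E1 i)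
    (mem_sdiff.2 ⟨tagSum_mem_embedSum.2 hiS, fun h => hiT (tagSum_mem_embedSum.1 h)⟩)
  obtain ⟨hjT, hjS⟩ := mem_sdiff.1 hj
  have hB1 : insert j ((embedSum E1 S (N - S.card)).erase (tagSum E1 i)) ⊆ Γ :=
    insert_subset (hBG' hjT) ((erase_subset _ _).trans hBG)
  have hB2 : (insert (tagSum E1 i) (embedSum E1 T (N - T.card))).erase j ⊆ Γ :=
    (erase_subset _ _).trans (insert_subset hiG hBG')
  rw [hval _ hBG, hval _ hBG', hval _ hB1, hval _ hB2, foldSum_embedSum, foldSum_embedSum] at h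
  have hj' : (∃ t, j = tagSum E1 t) ∨ ∃ d, j = .inr d := by
    have := hBG' hjT
    rcases j with (t | t) | d
    · have ht : t ∈ E1 := by simpa [Γ] using this
      exact .inl ⟨t, by simp [tagSum, ht]⟩
    · have ht : t ∈ E2 ∧ t ∉ E1 := by simpa [Γ] using this
      exact .inl ⟨t, by simp [tagSum, ht]⟩
    · exact .inr ⟨d, rfl⟩
  rcases hj' with ⟨t, rfl⟩ | ⟨d, rfl⟩
  · refine .inr ⟨t, mem_sdiff.2 ⟨tagSum_mem_embedSum.1 hjT,
      fun h => hjS (tagSum_mem_embedSum.2 h)⟩, ?_⟩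
    convert h using 3 <;> ext x
    · rw [mem_foldSum_iff hB1]
      simp [tagSum_inj, tagSum_mem_embedSum]
    · rw [mem_foldSum_iff hB2]
      simp [tagSum_inj, tagSum_mem_embedSum]
  · left
    convert h using 3 <;> ext x
    · rw [mem_foldSum_iff hB1]
      simp [tagSum_inj, tagSum_mem_embedSum, tagSum_ne_inr]
    · rw [mem_foldSum_iff hB2]
      simp [tagSum_inj, tagSum_mem_embedSum, tagSum_ne_inr]

end TagSum

section WeightedRank

lemma Matroid.Indep.exists_symm_exchange {β : Type*} {M : Matroid β} {I J : Set β} {i : β}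
    (hI : M.Indep I) (hJ : M.Indep J) (hiI : i ∈ I) (hiJ : i ∉ J) :
    M.Indep (insert i J) ∨
      ∃ j ∈ J, j ∉ I ∧ M.Indep (insert j (I \ {i})) ∧ M.Indep (insert i J \ {j}) := by
  have hiE : i ∈ M.E := hI.subset_ground hiI
  by_cases hcl : i ∈ M.closure J
  · right
    by_contra! hcon
    have hC := hJ.fundCircuit_isCircuit hcl hiJ
    refine hI.notMem_closure_sdiff_of_mem hiI
      (M.closure_subset_closure_of_subset_closure ?_
        (hC.mem_closure_sdiff_singleton_of_mem (M.mem_fundCircuit i J)))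
    rintro j ⟨hjC, hji⟩
    have hjJ : j ∈ J := (M.fundCircuit_subset_insert i J hjC).resolve_left hji
    have hI' : M.Indep (I \ {i}) := hI.sdiff {i}
    by_cases hjI : j ∈ I
    · exact M.mem_closure_of_mem ⟨hjI, hji⟩ hI'.subset_ground
    · refine hI'.mem_closure_iff'.2 ⟨hJ.subset_ground hjJ, fun h => ?_⟩
      exact absurd ((hJ.mem_fundCircuit_iff hcl hiJ).1 hjC) (hcon j hjJ hjI h)
  · exact .inl ((hJ.notMem_closure_iff hiE).1 hcl).1

lemma FinMatroid.exists_symm_exchange (M : FinMatroid α) {I J : Finset α} {i : α}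
    (hI : M.Indep I) (hJ : M.Indep J) (hiI : i ∈ I) (hiJ : i ∉ J) :
    M.Indep (insert i J) ∨
      ∃ j ∈ J, j ∉ I ∧ M.Indep (insert j (I.erase i)) ∧ M.Indep ((insert i J).erase j) := by
  obtain ⟨N, hN⟩ : ∃ N : Matroid α, ∀ I : Finset α, N.Indep I ↔ M.Indep I :=
    ⟨(IndepMatroid.ofFinset (M.E : Set α) M.Indep M.indep_empty M.indep_subset M.indep_aug
      (fun I hI => mod_cast M.subset_ground hI)).matroid,
      fun I => IndepMatroid.ofFinset_indep (M.E : Set α) M.Indep M.indep_empty M.indep_subset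
        M.indep_aug (fun I hI => mod_cast M.subset_ground hI)⟩
  rcases Matroid.Indep.exists_symm_exchange ((hN I).2 hI) ((hN J).2 hJ) hiI hiJ with
    h | ⟨j, hjJ, hjI, h1, h2⟩
  · exact .inl ((hN _).1 (by simpa using h))
  · exact .inr ⟨j, hjJ, hjI, (hN _).1 (by simpa using h1), (hN _).1 (by simpa using h2)⟩

variable (M : FinMatroid α) (w : α → ℝ)

lemma weightedRank_set_finite (T : Finset α) :
    {x : ℝ | ∃ I : Finset α, M.Indep I ∧ I ⊆ T ∧ x = ∑ i ∈ I, w i}.Finite := by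
  refine (T.powerset.finite_toSet.image (fun I => ∑ i ∈ I, w i)).subset ?_
  rintro x ⟨I, -, hI, rfl⟩
  exact ⟨I, mem_coe.2 (mem_powerset.2 hI), rfl⟩

variable {M} in
lemma sum_le_weightedRank {I T : Finset α} (hI : M.Indep I) (hIT : I ⊆ T) :
    ∑ i ∈ I, w i ≤ weightedRank M w T :=
  le_csSup (weightedRank_set_finite M w T).bddAbove ⟨I, hI, hIT, rfl⟩

lemma exists_weightedRank_eq (T : Finset α) :
    ∃ I : Finset α, M.Indep I ∧ I ⊆ T ∧ weightedRank M w T = ∑ i ∈ I, w i := by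
  refine Set.Nonempty.csSup_mem ?_ (weightedRank_set_finite M w T)
  exact ⟨_, ∅, M.indep_empty, empty_subset _, rfl⟩

lemma isValuation_weightedRank (hw : ∀ i, 0 ≤ w i) : IsValuation M.E (weightedRank M w) := by
  refine ⟨?_, fun S _ => ?_, fun S T hST _ => ?_⟩
  · obtain ⟨I, -, hI, h⟩ := exists_weightedRank_eq M w ∅
    rw [h, subset_empty.1 hI, sum_empty]
  · obtain ⟨I, -, -, h⟩ := exists_weightedRank_eq M w S
    exact h ▸ sum_nonneg fun i _ => hw i
  · obtain ⟨I, hI, hIS, h⟩ := exists_weightedRank_eq M w S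
    exact h ▸ sum_le_weightedRank w hI (hIS.trans hST)

lemma mNatExchange_weightedRank : MNatExchange M.E (weightedRank M w) := by
  intro S T _ _ i hi
  obtain ⟨hiS, hiT⟩ := mem_sdiff.1 hi
  obtain ⟨I, hI, hIS, hS⟩ := exists_weightedRank_eq M w S
  obtain ⟨J, hJ, hJT, hT⟩ := exists_weightedRank_eq M w T
  rw [hS, hT]
  by_cases hiI : i ∈ I
  · have hiJ : i ∉ J := fun h => hiT (hJT h)
    have hIi := add_sum_erase I w hiI
    have hJi := sum_insert (f := w) hiJ
    rcases M.exists_symm_exchange hI hJ hiI hiJ with h | ⟨j, hjJ, hjI, h1, h2⟩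
    · left
      have k1 := sum_le_weightedRank w (M.indep_subset hI (erase_subset i I))
        (erase_subset_erase i hIS)
      have k2 := sum_le_weightedRank w h (insert_subset_insert i hJT)
      linarith
    · have hIj := sum_insert (f := w) (fun h => hjI (mem_of_mem_erase h) : j ∉ I.erase i)
      have hJj := add_sum_erase (insert i J) w (mem_insert_of_mem hjJ)
      by_cases hjS : j ∈ S
      · left
        have k1 := sum_le_weightedRank w h1 (insert_subset
          (mem_erase.2 ⟨ne_of_mem_of_not_mem hjJ hiJ, hjS⟩) (erase_subset_erase i hIS))
        have k2 := sum_le_weightedRank w h2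
          ((erase_subset _ _).trans (insert_subset_insert i hJT))
        linarith
      · refine .inr ⟨j, mem_sdiff.2 ⟨hJT hjJ, hjS⟩, ?_⟩
        have k1 := sum_le_weightedRank w h1 (insert_subset_insert j (erase_subset_erase i hIS))
        have k2 := sum_le_weightedRank w h2 (erase_subset_erase j (insert_subset_insert i hJT))
        linarith
  · left
    exact add_le_add (sum_le_weightedRank w hI (subset_erase.2 ⟨hIS, hiI⟩))
      (sum_le_weightedRank w hJ (hJT.trans (subset_insert i T)))

end WeightedRank

section Endowment

variable {E : Finset α} {u : Finset α → ℝ}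

lemma IsValuation.endow (h : IsValuation E u) {T : Finset α} (hT : T ⊆ E) :
    IsValuation (E \ T) (fun S => u (S ∪ T) - u T) := by
  have hsub : ∀ {S}, S ⊆ E \ T → S ∪ T ⊆ E := fun hS => union_subset (hS.trans sdiff_subset) hT
  refine ⟨by simp, fun S hS => ?_, fun S S' hSS' hS' => ?_⟩
  · exact sub_nonneg.2 (h.2.2 subset_union_right (hsub hS))
  · exact sub_le_sub_right (h.2.2 (union_subset_union_left hSS') (hsub hS')) _

lemma MNatExchange.endow (h : MNatExchange E u) {T : Finset α} (hT : T ⊆ E) :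
    MNatExchange (E \ T) (fun S => u (S ∪ T) - u T) := by
  intro S S' hS hS' i hi
  have hsub : ∀ {S}, S ⊆ E \ T → S ∪ T ⊆ E := fun hS => union_subset (hS.trans sdiff_subset) hT
  obtain ⟨hiS, hiS'⟩ := mem_sdiff.1 hi
  have hiT : i ∉ T := (mem_sdiff.1 (hS hiS)).2
  have e1 : (S ∪ T).erase i = S.erase i ∪ T := by
    rw [erase_union_distrib, erase_eq_of_notMem hiT]
  rcases h (hsub hS) (hsub hS') i (by simp [hiS, hiS', hiT]) with h | ⟨j, hj, h⟩
  · left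
    rw [e1, ← insert_union] at h
    linarith
  · have hj' : j ∈ S' \ S ∧ j ∉ T := by
      simp only [mem_sdiff, mem_union] at hj ⊢
      tauto
    refine .inr ⟨j, hj'.1, ?_⟩
    rw [e1, ← insert_union, ← insert_union, erase_union_distrib,
      erase_eq_of_notMem hj'.2] at h
    linarith

end Endowment

/-- Every matroid based valuation is a gross substitutes valuation. -/
lemma MBV.grossSubstitutes {n : ℕ} {E : Finset (Fin n)} {u : Finset (Fin n) → ℝ}
    (h : MBV n E u) : GrossSubstitutes E u := by
  induction h with
  | wrank M w hw => exact ⟨isValuation_weightedRank M w hw, mNatExchange_weightedRank M w⟩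
  | merge _ _ ih1 ih2 => exact ⟨ih1.1.mergeVal ih2.1, MNatExchange.mergeVal ih1.2 ih2.2⟩
  | endow T hT _ ih => exact ⟨ih.1.endow hT, MNatExchange.endow ih.2 hT⟩

section TwoBlock

variable {β : Type*} (P : β → Prop) [DecidablePred P]

/-- The valuation that is `1` on nonempty sets inside one of the two blocks `P`, `¬ P`
and `3 / 2` on sets meeting both blocks. -/
noncomputable def twoBlock (S : Finset β) : ℝ :=
  if (∃ x ∈ S, P x) ∧ (∃ x ∈ S, ¬ P x) then 3 / 2
  else if (∃ x ∈ S, P x) ∨ (∃ x ∈ S, ¬ P x) then 1 else 0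

lemma twoBlock_not : twoBlock (fun x => ¬ P x) = twoBlock P := by
  funext S
  have h : (∃ x ∈ S, ¬¬ P x) ↔ ∃ x ∈ S, P x := by simp only [not_not]
  by_cases hA : ∃ x ∈ S, P x <;> by_cases hB : ∃ x ∈ S, ¬ P x <;>
    simp only [twoBlock, h, hA, hB, and_self, and_true, and_false, or_self,
      or_true, or_false, if_true, if_false]

lemma twoBlock_le (S : Finset β) : twoBlock P S ≤ 3 / 2 := by
  unfold twoBlock
  split_ifs <;> norm_num

lemma twoBlock_mono {S T : Finset β} (hST : S ⊆ T) : twoBlock P S ≤ twoBlock P T := by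
  have h1 : (∃ x ∈ S, P x) → ∃ x ∈ T, P x := fun ⟨x, hx, hP⟩ => ⟨x, hST hx, hP⟩
  have h2 : (∃ x ∈ S, ¬ P x) → ∃ x ∈ T, ¬ P x := fun ⟨x, hx, hP⟩ => ⟨x, hST hx, hP⟩
  by_cases hA : ∃ x ∈ S, P x
  · by_cases hB : ∃ x ∈ S, ¬ P x
    · rw [twoBlock, twoBlock, if_pos ⟨hA, hB⟩, if_pos ⟨h1 hA, h2 hB⟩]
    · rw [twoBlock, if_neg fun h => hB h.2, if_pos (.inl hA), twoBlock]
      split_ifs with _ h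
      · norm_num
      · exact le_rfl
      · exact absurd (.inl (h1 hA)) h
  · by_cases hB : ∃ x ∈ S, ¬ P x
    · rw [twoBlock, if_neg fun h => hA h.1, if_pos (.inr hB), twoBlock]
      split_ifs with _ h
      · norm_num
      · exact le_rfl
      · exact absurd (.inr (h2 hB)) h
    · rw [twoBlock, if_neg fun h => hA h.1, if_neg fun h => h.elim hA hB, twoBlock]
      split_ifs <;> norm_num

variable {P}

lemma twoBlock_congr {S T : Finset β} (h1 : (∃ x ∈ S, P x) ↔ ∃ x ∈ T, P x)
    (h2 : (∃ x ∈ S, ¬ P x) ↔ ∃ x ∈ T, ¬ P x) : twoBlock P S = twoBlock P T := by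
  simp only [twoBlock, h1, h2]

lemma twoBlock_of_both {S : Finset β} (h1 : ∃ x ∈ S, P x) (h2 : ∃ x ∈ S, ¬ P x) :
    twoBlock P S = 3 / 2 := if_pos ⟨h1, h2⟩

lemma twoBlock_of_same {S : Finset β} {x : β} (hx : x ∈ S) (h : ∀ y ∈ S, P y ↔ P x) :
    twoBlock P S = 1 := by
  rw [twoBlock, if_neg, if_pos]
  · by_cases hP : P x
    · exact .inl ⟨x, hx, hP⟩
    · exact .inr ⟨x, hx, hP⟩
  · rintro ⟨⟨y, hy, hPy⟩, z, hz, hPz⟩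
    exact hPz ((h z hz).2 ((h y hy).1 hPy))

lemma one_le_twoBlock {S : Finset β} (h : S.Nonempty) : 1 ≤ twoBlock P S := by
  obtain ⟨x, hx⟩ := h
  rw [← twoBlock_of_same (P := P) (mem_singleton_self x) (by simp)]
  exact twoBlock_mono P (singleton_subset_iff.2 hx)

lemma twoBlock_singleton (x : β) : twoBlock P {x} = 1 :=
  twoBlock_of_same (mem_singleton_self x) (by simp)

lemma twoBlock_empty : twoBlock P ∅ = 0 := by simp [twoBlock]

end TwoBlock

section TwoBlockExchange

variable {P : α → Prop} [DecidablePred P]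

lemma twoBlock_exchange_of_mem {S T : Finset α} {i : α} (hiS : i ∈ S) (hiT : i ∉ T) (hi : P i) :
    twoBlock P S + twoBlock P T ≤ twoBlock P (S.erase i) + twoBlock P (insert i T) ∨
      ∃ j ∈ T \ S, twoBlock P S + twoBlock P T ≤
        twoBlock P (insert j (S.erase i)) + twoBlock P ((insert i T).erase j) := by
  have hmono : twoBlock P T ≤ twoBlock P (insert i T) := twoBlock_mono P (subset_insert i T)
  have hS2 : (∃ x ∈ S, ¬ P x) ↔ ∃ x ∈ S.erase i, ¬ P x := by
    refine ⟨fun ⟨x, hx, hP⟩ => ⟨x, mem_erase.2 ⟨fun h => hP (h ▸ hi), hx⟩, hP⟩,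
      fun ⟨x, hx, hP⟩ => ⟨x, mem_of_mem_erase hx, hP⟩⟩
  by_cases h1 : ∃ x ∈ S.erase i, P x
  · left
    have hS1 : (∃ x ∈ S, P x) ↔ ∃ x ∈ S.erase i, P x := iff_of_true ⟨i, hiS, hi⟩ h1
    rw [twoBlock_congr hS1 hS2]
    linarith
  by_cases h2 : ∃ j ∈ T, P j
  · right
    obtain ⟨j, hjT, hj⟩ := h2
    have hji : j ≠ i := ne_of_mem_of_not_mem hjT hiT
    refine ⟨j, mem_sdiff.2 ⟨hjT, fun h => h1 ⟨j, mem_erase.2 ⟨hji, h⟩, hj⟩⟩, ?_⟩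
    have e1 : twoBlock P S = twoBlock P (insert j (S.erase i)) :=
      twoBlock_congr (iff_of_true ⟨i, hiS, hi⟩ ⟨j, mem_insert_self _ _, hj⟩)
        (by rw [hS2]; simp [hj])
    have e2 : twoBlock P T = twoBlock P ((insert i T).erase j) := by
      refine twoBlock_congr (iff_of_true ⟨j, hjT, hj⟩
        ⟨i, mem_erase.2 ⟨hji.symm, mem_insert_self _ _⟩, hi⟩) ⟨?_, ?_⟩
      · rintro ⟨x, hx, hP⟩
        exact ⟨x, mem_erase.2 ⟨fun h => hP (h ▸ hj), mem_insert_of_mem hx⟩, hP⟩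
      · rintro ⟨x, hx, hP⟩
        exact ⟨x, mem_of_mem_insert_of_ne (mem_of_mem_erase hx) (fun h => hP (h ▸ hi)), hP⟩
    rw [e1, e2]
  have hT : T.Nonempty → twoBlock P T = 1 := fun ⟨x, hx⟩ => twoBlock_of_same hx
    fun y hy => iff_of_false (fun h => h2 ⟨y, hy, h⟩) fun h => h2 ⟨x, hx, h⟩
  rcases T.eq_empty_or_nonempty with rfl | ⟨t, ht⟩
  · left
    rw [insert_empty_eq, twoBlock_singleton, twoBlock_empty]
    by_cases h3 : (S.erase i).Nonempty
    · have := one_le_twoBlock (P := P) h3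
      have := twoBlock_le P S
      linarith
    · rw [not_nonempty_iff_eq_empty] at h3
      rw [← insert_erase hiS, h3, insert_empty_eq, twoBlock_singleton, erase_singleton,
        twoBlock_empty, add_comm]
  have htP : ¬ P t := fun h => h2 ⟨t, ht, h⟩
  by_cases h3 : (S.erase i).Nonempty
  · left
    rw [hT ⟨t, ht⟩, twoBlock_of_both (S := insert i T) ⟨i, mem_insert_self _ _, hi⟩
      ⟨t, mem_insert_of_mem ht, htP⟩]
    have := one_le_twoBlock (P := P) h3
    have := twoBlock_le P S
    linarith
  · right
    have hS : S = {i} := by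
      rw [not_nonempty_iff_eq_empty] at h3
      rw [← insert_erase hiS, h3, insert_empty_eq]
    have hti : t ≠ i := ne_of_mem_of_not_mem ht hiT
    refine ⟨t, mem_sdiff.2 ⟨ht, by simpa [hS] using hti⟩, ?_⟩
    rw [hT ⟨t, ht⟩, hS, twoBlock_singleton]
    exact add_le_add (one_le_twoBlock (insert_nonempty _ _))
      (one_le_twoBlock ⟨i, mem_erase.2 ⟨hti.symm, mem_insert_self _ _⟩⟩)

variable (P) in
lemma grossSubstitutes_twoBlock (E : Finset α) : GrossSubstitutes E (twoBlock P) := by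
  refine ⟨⟨twoBlock_empty, fun S _ => ?_, fun S T h _ => twoBlock_mono P h⟩, ?_⟩
  · exact twoBlock_empty (P := P) ▸ twoBlock_mono P (empty_subset S)
  · intro S T _ _ i hi
    obtain ⟨hiS, hiT⟩ := mem_sdiff.1 hi
    by_cases hP : P i
    · exact twoBlock_exchange_of_mem hiS hiT hP
    · have := twoBlock_exchange_of_mem (P := fun x => ¬ P x) hiS hiT hP
      rwa [twoBlock_not] at this

end TwoBlockExchange

section NotMatroidBased

lemma mergeVal_comm (E1 E2 : Finset α) (u1 u2 : Finset α → ℝ) :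
    mergeVal E1 E2 u1 u2 = mergeVal E2 E1 u2 u1 := by
  funext S
  unfold mergeVal
  congr 1
  ext x
  constructor <;> rintro ⟨S1, S2, rfl, hd, h1, h2, rfl⟩ <;>
    exact ⟨S2, S1, union_comm _ _, hd.symm, h2, h1, add_comm _ _⟩

variable {P : α → Prop} [DecidablePred P] {E1 E2 : Finset α} {u1 u2 : Finset α → ℝ}

lemma mergeVal_singleton (h1 : IsValuation E1 u1) (h2 : IsValuation E2 u2) {i : α}
    (hi : i ∈ E1 ∪ E2) :
    (i ∈ E1 ∧ u1 {i} = mergeVal E1 E2 u1 u2 {i}) ∨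
      (i ∈ E2 ∧ u2 {i} = mergeVal E1 E2 u1 u2 {i}) := by
  obtain ⟨S1, S2, hS, hd, hS1, hS2, h⟩ := exists_mergeVal_eq u1 u2 (singleton_subset_iff.2 hi)
  have hS1' : S1 ⊆ {i} := hS ▸ subset_union_left
  rcases subset_singleton_iff.1 hS1' with rfl | rfl
  · rw [empty_union] at hS
    subst hS
    exact .inr ⟨singleton_subset_iff.1 hS2, by rw [h, h1.1, zero_add]⟩
  · have hS2' : S2 = ∅ := by
      have : S2 ⊆ {i} := hS ▸ subset_union_right
      exact disjoint_self.1 (hd.mono_left this)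
    subst hS2'
    exact .inl ⟨singleton_subset_iff.1 hS1, by rw [h, h2.1, add_zero]⟩

lemma eq_twoBlock_of_mergeVal_eq [Fintype α] (h1 : IsValuation E1 u1)
    (h2 : IsValuation E2 u2)
    (hE : E1 ∪ E2 = univ) (hv : mergeVal E1 E2 u1 u2 = twoBlock P)
    (hP : ∀ x, ∃ y, y ≠ x ∧ (P y ↔ P x)) {i i' : α} (hii' : i ≠ i')
    (hi : i ∈ E1) (hi' : i' ∈ E1) (hui : u1 {i} = 1) (hui' : u1 {i'} = 1) :
    E1 = univ ∧ u1 = twoBlock P := by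
  have hub : ∀ {S1 S2 : Finset α}, Disjoint S1 S2 → S1 ⊆ E1 → S2 ⊆ E2 →
      u1 S1 + u2 S2 ≤ twoBlock P (S1 ∪ S2) := fun hd hS1 hS2 => hv ▸ le_mergeVal u1 u2 hd hS1 hS2
  have hhalf : ∀ j ∈ E2, u2 {j} ≤ 1 / 2 := by
    intro j hj
    obtain ⟨k, hk, hkj, huk⟩ : ∃ k ∈ E1, k ≠ j ∧ u1 {k} = 1 := by
      by_cases h : i = j
      · exact ⟨i', hi', fun h' => hii' (h.trans h'.symm), hui'⟩
      · exact ⟨i, hi, h, hui⟩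
    have := hub (S1 := {k}) (S2 := {j}) (by simpa using hkj) (by simpa using hk) (by simpa using hj)
    have := this.trans (twoBlock_le P _)
    linarith
  have hone : ∀ j, j ∈ E1 ∧ u1 {j} = 1 := by
    intro j
    have := mergeVal_singleton h1 h2 (hE ▸ mem_univ j : j ∈ E1 ∪ E2)
    rw [hv, twoBlock_singleton] at this
    refine this.resolve_right fun ⟨hj, huj⟩ => ?_
    have := hhalf j hj
    linarith
  have hE1 : E1 = univ := eq_univ_of_forall fun j => (hone j).1
  have hzero : ∀ j ∈ E2, u2 {j} ≤ 0 := by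
    intro j hj
    obtain ⟨k, hkj, hk⟩ := hP j
    have := hub (S1 := {k}) (S2 := {j}) (by simpa using hkj) (by simpa using (hone k).1)
      (by simpa using hj)
    rw [twoBlock_of_same (x := j) (by simp) (by simp [hk]), (hone k).2] at this
    linarith
  have hpair : ∀ a b, P a → ¬ P b → 3 / 2 ≤ u1 {a, b} := by
    intro a b ha hb
    have hab : a ≠ b := fun h => hb (h ▸ ha)
    obtain ⟨S1, S2, hS, hd, hS1, hS2, h⟩ :=
      exists_mergeVal_eq u1 u2 (hE ▸ subset_univ _ : ({a, b} : Finset α) ⊆ E1 ∪ E2)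
    rw [hv, twoBlock_of_both ⟨a, by simp, ha⟩ ⟨b, by simp, hb⟩] at h
    rw [disjoint_left] at hd
    have hm : ∀ x, x ∈ S1 ∨ x ∈ S2 ↔ x = a ∨ x = b := by
      intro x
      rw [← mem_union, ← hS, mem_insert, mem_singleton]
    by_cases haS : a ∈ S1 <;> by_cases hbS : b ∈ S1
    · have e1 : S1 = {a, b} := by ext x; have := hm x; clear h hub; grind
      have e2 : S2 = ∅ := by ext x; have := hm x; clear h hub; grind
      rw [e1, e2, h2.1] at h
      linarith
    · have e1 : S1 = {a} := by ext x; have := hm x; clear h hub; grind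
      have e2 : S2 = {b} := by ext x; have := hm x; have := hm b; clear h hub; grind
      have := hzero b (hS2 (by simp [e2]))
      rw [e1, e2, (hone a).2] at h
      linarith
    · have e1 : S1 = {b} := by ext x; have := hm x; clear h hub; grind
      have e2 : S2 = {a} := by ext x; have := hm x; have := hm a; clear h hub; grind
      have := hzero a (hS2 (by simp [e2]))
      rw [e1, e2, (hone b).2] at h
      linarith
    · have e1 : S1 = ∅ := by ext x; have := hm x; clear h hub; grind
      rw [e1, h1.1] at h
      obtain ⟨k, hka, hk⟩ := hP a
      have hkS : k ∉ S2 := fun hkS => by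
        rcases (hm k).1 (.inr hkS) with h | h
        · exact hka h
        · exact hb (h ▸ hk.2 ha)
      have := (hub (S1 := {k}) (by simpa using hkS) (by simpa using (hone k).1) hS2).trans
        (twoBlock_le P _)
      have := (hone k).2
      linarith
  refine ⟨hE1, funext fun S => le_antisymm ?_ ?_⟩
  · have := hub (S1 := S) (disjoint_empty_right S) (hE1 ▸ subset_univ S) (empty_subset E2)
    rwa [h2.1, add_zero, union_empty] at this
  · have hS : S ⊆ E1 := hE1 ▸ subset_univ S
    by_cases h : (∃ x ∈ S, P x) ∧ ∃ x ∈ S, ¬ P x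
    · obtain ⟨⟨a, haS, ha⟩, b, hbS, hb⟩ := h
      exact (twoBlock_le P S).trans ((hpair a b ha hb).trans
        (h1.2.2 (insert_subset haS (singleton_subset_iff.2 hbS)) hS))
    · rw [twoBlock, if_neg h]
      split_ifs with h'
      · obtain ⟨x, hx⟩ : S.Nonempty := by
          rcases h' with ⟨x, hx, -⟩ | ⟨x, hx, -⟩ <;> exact ⟨x, hx⟩
        exact (hone x).2 ▸ h1.2.2 (singleton_subset_iff.2 hx) hS
      · exact h1.2.1 S hS

lemma weightedRank_ne_twoBlock (M : FinMatroid α) (w : α → ℝ) {a b : α} (ha : P a) (hb : ¬ P b) :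
    weightedRank M w ≠ twoBlock P := by
  intro h
  have hw : ∀ i, w i = 1 := by
    intro i
    obtain ⟨I, -, hI, hi⟩ := exists_weightedRank_eq M w {i}
    rw [h, twoBlock_singleton] at hi
    rcases subset_singleton_iff.1 hI with rfl | rfl
    · simp at hi
    · simpa using hi.symm
  obtain ⟨I, -, -, hI⟩ := exists_weightedRank_eq M w {a, b}
  rw [h, twoBlock_of_both ⟨a, by simp, ha⟩ ⟨b, by simp, hb⟩] at hI
  simp only [hw, sum_const, nsmul_eq_mul, mul_one] at hI
  have : ((3 : ℕ) : ℝ) = ((2 * I.card : ℕ) : ℝ) := by push_cast; linarith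
  have := Nat.cast_injective this
  omega

lemma not_mbv_twoBlock {n : ℕ} {P : Fin n → Prop} [DecidablePred P]
    (hP : ∀ x, ∃ y, y ≠ x ∧ (P y ↔ P x)) {a b : Fin n} (ha : P a) (hb : ¬ P b) :
    ¬ MBV n univ (twoBlock P) := by
  suffices ∀ E u, MBV n E u → E = univ → u ≠ twoBlock P from fun h => this _ _ h rfl rfl
  intro E u h
  induction h with
  | wrank M w hw => exact fun _ => weightedRank_ne_twoBlock M w ha hb
  | @merge E1 E2 u1 u2 hu1 hu2 ih1 ih2 =>
    intro hE hv
    have h1 := hu1.grossSubstitutes.1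
    have h2 := hu2.grossSubstitutes.1
    have hside : ∀ i, (i ∈ E1 ∧ u1 {i} = 1) ∨ (i ∈ E2 ∧ u2 {i} = 1) := by
      intro i
      have := mergeVal_singleton h1 h2 (hE ▸ mem_univ i : i ∈ E1 ∪ E2)
      rwa [hv, twoBlock_singleton] at this
    have hone1 : ∀ i i', i ≠ i' → (i ∈ E1 ∧ u1 {i} = 1) → ¬ (i' ∈ E1 ∧ u1 {i'} = 1) := by
      intro i i' hii' hi hi'
      have := eq_twoBlock_of_mergeVal_eq h1 h2 hE hv hP hii' hi.1 hi'.1 hi.2 hi'.2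
      exact ih1 this.1 this.2
    have hone2 : ∀ i i', i ≠ i' → (i ∈ E2 ∧ u2 {i} = 1) → ¬ (i' ∈ E2 ∧ u2 {i'} = 1) := by
      intro i i' hii' hi hi'
      rw [union_comm] at hE
      rw [mergeVal_comm] at hv
      have := eq_twoBlock_of_mergeVal_eq h2 h1 hE hv hP hii' hi.1 hi'.1 hi.2 hi'.2
      exact ih2 this.1 this.2
    obtain ⟨c, hca, hc⟩ := hP a
    have hab : a ≠ b := fun h => hb (h ▸ ha)
    have hcb : c ≠ b := fun h => hb (h ▸ hc.2 ha)
    rcases hside a with h | h <;> rcases hside b with h' | h' <;> rcases hside c with h'' | h''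
    · exact hone1 a b hab h h'
    · exact hone1 a b hab h h'
    · exact hone1 c a hca h'' h
    · exact hone2 c b hcb h'' h'
    · exact hone1 c b hcb h'' h'
    · exact hone2 c a hca h'' h
    · exact hone2 a b hab h h'
    · exact hone2 a b hab h h'
  | @endow E u T hT hu ih =>
    intro hE hv
    have hT' : T = ∅ := by
      refine eq_empty_of_forall_notMem fun x hx => ?_
      exact (mem_sdiff.1 (hE ▸ mem_univ x : x ∈ E \ T)).2 hx
    subst hT'
    refine ih (by simpa using hE) (funext fun S => ?_)
    have := congrFun hv S
    simpa [hu.grossSubstitutes.1.1] using this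

end NotMatroidBased

/-- For every `n ≥ 4` there is a gross substitutes valuation with ground set
exactly `[n]` that is not in `MBV_{n,n}`; in particular `MBV_{n,n}` is a
strict subclass of the gross substitutes valuations. -/
theorem mbv_strict_subclass (n : ℕ) (hn : 4 ≤ n) :
    (∀ (E : Finset (Fin n)) (u : Finset (Fin n) → ℝ),
      MBV n E u → GrossSubstitutes E u) ∧
    ∃ v : Finset (Fin n) → ℝ,
      GrossSubstitutes (Finset.univ : Finset (Fin n)) v ∧
      ¬ MBV n Finset.univ v := by
  refine ⟨fun E u h => h.grossSubstitutes, twoBlock (fun x : Fin n => x.val < 2),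
    grossSubstitutes_twoBlock _ _,
    not_mbv_twoBlock ?_ (a := ⟨0, by omega⟩) (b := ⟨2, by omega⟩) (by simp) (by simp)⟩
  intro x
  have hx := x.isLt
  obtain ⟨y, hy, hyx, hiff⟩ : ∃ y < n, y ≠ x.val ∧ (y < 2 ↔ x.val < 2) := by
    by_cases h : x.val < 2
    · exact ⟨1 - x.val, by omega, by omega, by omega⟩
    · by_cases h' : x.val = 2
      · exact ⟨3, by omega, by omega, by omega⟩
      · exact ⟨2, by omega, by omega, by omega⟩
  exact ⟨⟨y, hy⟩, fun h => hyx (congrArg Fin.val h), hiff⟩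
end

section
/- A valuation u on [n] is a gross substitutes valuation (i.e., satisfies the M♮-exchange property) if and only if for every price vector p ∈ ℝ^n, the demand set D_u(p) = argmax_{S ⊆ [n]} ( u(S) − Σ_{i∈S} p_i ) is an M♮-convex family of subsets of [n]. -/
open Finset

variable {α : Type*} [DecidableEq α]

/-- The demand set `D_u(p)`: subsets maximizing `u S - ∑_{i ∈ S} p i`. -/
def demandSet {n : ℕ} (u : Finset (Fin n) → ℝ) (p : Fin n → ℝ) :
    Set (Finset (Fin n)) :=
  {S | ∀ T : Finset (Fin n), u T - ∑ i ∈ T, p i ≤ u S - ∑ i ∈ S, p i}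

/-- A family of subsets of `[n]` is M♮-convex. -/
def MConvexFamily {n : ℕ} (F : Set (Finset (Fin n))) : Prop :=
  ∀ X ∈ F, ∀ Y ∈ F, ∀ i ∈ X \ Y,
    (X.erase i ∈ F ∧ insert i Y ∈ F) ∨
      ∃ j ∈ Y \ X, insert j (X.erase i) ∈ F ∧ (insert i Y).erase j ∈ F

section FixedCardinality

variable {β : Type*} [DecidableEq β] {f : Finset β → ℝ}

/-- For functions on the subsets of a fixed size, the exchange property for pairs of sets
that differ in two elements implies the exchange property for all pairs of sets. -/
theorem exists_exchange_of_local_exchange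
    (hf : ∀ (S : Finset β) (a b c d : β), a ∉ S → b ∉ S → c ∉ S → d ∉ S →
      a ≠ b → a ≠ c → a ≠ d → b ≠ c → b ≠ d → c ≠ d →
      f (insert a (insert b S)) + f (insert c (insert d S)) ≤
          f (insert a (insert c S)) + f (insert b (insert d S)) ∨
        f (insert a (insert b S)) + f (insert c (insert d S)) ≤
          f (insert a (insert d S)) + f (insert b (insert c S)))
    {X Y : Finset β} (hXY : #X = #Y) {i : β} (hi : i ∈ X \ Y) :
    ∃ j ∈ Y \ X, f X + f Y ≤ f (insert j (X.erase i)) + f ((insert i Y).erase j) := by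
  induction hk : #(X \ Y) generalizing Y with
  | zero => exact absurd (card_eq_zero.mp hk ▸ hi) (notMem_empty i)
  | succ k ih =>
  have hne : (Y \ X).Nonempty := by
    rw [← card_pos, ← card_sdiff_comm hXY]
    omega
  obtain ⟨hiX, hiY⟩ := mem_sdiff.mp hi
  by_cases hs : X \ Y = {i}
  · obtain ⟨j, hj⟩ : ∃ j, Y \ X = {j} := by
      rw [← card_eq_one, ← card_sdiff_comm hXY, hs, card_singleton]
    have hX := fun x => Finset.ext_iff.mp hs x
    have hY := fun x => Finset.ext_iff.mp hj x
    refine ⟨j, by simp [hj], ?_⟩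
    have h₁ : insert j (X.erase i) = Y := by
      ext x; clear hf ih; have := hX x; have := hY x; have := hY j; grind
    have h₂ : (insert i Y).erase j = X := by
      ext x; clear hf ih; have := hX x; have := hY x; have := hY j; grind
    rw [h₁, h₂, add_comm]
  obtain ⟨a, ha, hai⟩ : ∃ a ∈ X \ Y, a ≠ i := by
    by_contra! h
    exact hs (eq_singleton_iff_unique_mem.mpr ⟨hi, h⟩)
  obtain ⟨haX, haY⟩ := mem_sdiff.mp ha
  by_contra! hlt
  obtain ⟨b, hb, hmax⟩ := exists_max_image (Y \ X)
    (fun v => f ((insert a Y).erase v) + f (insert v (X.erase i))) hne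
  obtain ⟨hbY, hbX⟩ := mem_sdiff.mp hb
  have hcard : #X = #((insert a Y).erase b) := by
    rw [card_erase_of_mem (by simp [hbY]), card_insert_of_notMem haY, hXY]
    simp
  have hdiff : X \ (insert a Y).erase b = (X \ Y).erase a := by
    clear hf ih hlt hmax; ext x; grind
  obtain ⟨v, hv, hle⟩ := ih hcard (by clear hf ih hlt hmax; grind)
    (by rw [hdiff, card_erase_of_mem ha, hk]; rfl)
  obtain ⟨hvb, hvY, hvX⟩ : v ≠ b ∧ v ∈ Y ∧ v ∉ X := by
    clear hf ih hlt hmax hle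
    grind
  have e₁ : (insert i ((insert a Y).erase b)).erase v =
      insert a (insert i ((Y.erase b).erase v)) := by clear hf ih hlt hmax; ext x; grind
  have e₂ : insert b (insert v ((Y.erase b).erase v)) = Y := by clear hf ih hlt hmax; ext x; grind
  have e₃ : insert a (insert b ((Y.erase b).erase v)) = (insert a Y).erase v := by clear hf ih hlt hmax; ext x; grind
  have e₄ : insert i (insert v ((Y.erase b).erase v)) = (insert i Y).erase b := by clear hf ih hlt hmax; ext x; grind
  have e₅ : insert a (insert v ((Y.erase b).erase v)) = (insert a Y).erase b := by clear hf ih hlt hmax; ext x; grind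
  have e₆ : insert i (insert b ((Y.erase b).erase v)) = (insert i Y).erase v := by clear hf ih hlt hmax; ext x; grind
  have hloc := hf ((Y.erase b).erase v) a i b v (by simp [haY]) (by simp [hiY]) (by simp)
    (by simp) hai (ne_of_mem_of_not_mem hbY haY).symm (ne_of_mem_of_not_mem hvY haY).symm
    (ne_of_mem_of_not_mem hbY hiY).symm (ne_of_mem_of_not_mem hvY hiY).symm hvb.symm
  rw [← e₁, e₂, e₃, e₄, e₅, e₆] at hloc
  have hv' := mem_sdiff.mpr ⟨hvY, hvX⟩
  have h₁ := hlt v hv'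
  have h₂ := hlt b hb
  have h₃ := hmax v hv'
  rcases hloc with h | h <;> linarith

end FixedCardinality

section LocalExchange

variable {u : Finset α → ℝ}

/-- The exchange property for two disjoint pairs over a common set follows from the exchange
property for a pair and a singleton. -/
theorem pair_pair_exchange
    (h : ∀ (S : Finset α) (a b c : α), a ∉ S → b ∉ S → c ∉ S → a ≠ b → a ≠ c → b ≠ c →
      u (insert a (insert b S)) + u (insert c S) ≤ u (insert b S) + u (insert a (insert c S)) ∨
        u (insert a (insert b S)) + u (insert c S) ≤ u (insert b (insert c S)) + u (insert a S))
    {S : Finset α} {a b c d : α} (ha : a ∉ S) (hb : b ∉ S) (hc : c ∉ S) (hd : d ∉ S)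
    (hab : a ≠ b) (hac : a ≠ c) (had : a ≠ d) (hbc : b ≠ c) (hbd : b ≠ d) (hcd : c ≠ d) :
    u (insert a (insert b S)) + u (insert c (insert d S)) ≤
        u (insert a (insert c S)) + u (insert b (insert d S)) ∨
      u (insert a (insert b S)) + u (insert c (insert d S)) ≤
        u (insert a (insert d S)) + u (insert b (insert c S)) := by
  have h₁ := h S c d a hc hd ha hcd hac.symm had.symm
  have h₂ := h S c d b hc hd hb hcd hbc.symm hbd.symm
  have h₃ := h S a b c ha hb hc hab hac hbc
  have h₄ := h S a b d ha hb hd hab had hbd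
  rw [insert_comm c a, insert_comm d a] at h₁
  rw [insert_comm c b, insert_comm d b] at h₂
  by_contra! hlt
  obtain ⟨hlt₁, hlt₂⟩ := hlt
  rcases h₁ with h₁ | h₁ <;> rcases h₂ with h₂ | h₂ <;> rcases h₃ with h₃ | h₃ <;>
    rcases h₄ with h₄ | h₄ <;> linarith

/-- Submodularity and the exchange property for a pair and a singleton imply the
M♮-exchange property. -/
theorem exchange_of_local_exchange
    (hsub : ∀ (S : Finset α) (a b : α), a ∉ S → b ∉ S → a ≠ b →
      u (insert a (insert b S)) + u S ≤ u (insert a S) + u (insert b S))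
    (h : ∀ (S : Finset α) (a b c : α), a ∉ S → b ∉ S → c ∉ S → a ≠ b → a ≠ c → b ≠ c →
      u (insert a (insert b S)) + u (insert c S) ≤ u (insert b S) + u (insert a (insert c S)) ∨
        u (insert a (insert b S)) + u (insert c S) ≤ u (insert b (insert c S)) + u (insert a S))
    (X Y : Finset α) {i : α} (hi : i ∈ X \ Y) :
    u X + u Y ≤ u (X.erase i) + u (insert i Y) ∨
      ∃ j ∈ Y \ X, u X + u Y ≤ u (insert j (X.erase i)) + u ((insert i Y).erase j) := by
  -- Padding with dummy elements makes the two sets equal in size.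
  obtain ⟨j, hj, hle⟩ := exists_exchange_of_local_exchange (f := fun S : Finset (α ⊕ ℕ) =>
    u S.toLeft) (X := X.disjSum (range #Y)) (Y := Y.disjSum (range #X)) (i := Sum.inl i)
    (by
      intro S a b c d ha hb hc hd hab hac had hbc hbd hcd
      rcases a with a | a <;> rcases b with b | b <;> rcases c with c | c <;>
        rcases d with d | d <;>
        simp only [toLeft_insert_inl, toLeft_insert_inr] <;>
        simp only [← mem_toLeft, ne_eq, Sum.inl.injEq]
          at ha hb hc hd hab hac had hbc hbd hcd
      · exact pair_pair_exchange h ha hb hc hd hab hac had hbc hbd hcd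
      · have := h _ a b c ha hb hc hab hac hbc
        clear h hsub
        grind
      · have := h _ a b d ha hb hd hab had hbd
        clear h hsub
        grind
      · have := hsub _ a b ha hb hab
        clear h hsub
        grind
      · have := h _ c d a hc hd ha hcd (Ne.symm hac) (Ne.symm had)
        rw [insert_comm c a, insert_comm d a] at this
        clear h hsub
        grind
      · clear h hsub; grind
      · clear h hsub; grind
      · clear h hsub; grind
      · have := h _ c d b hc hd hb hcd (Ne.symm hbc) (Ne.symm hbd)
        rw [insert_comm c b, insert_comm d b] at this
        clear h hsub
        grind
      · clear h hsub; grind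
      · clear h hsub; grind
      · clear h hsub; grind
      · have := hsub _ c d hc hd hcd
        clear h hsub
        grind
      · clear h hsub; grind
      · clear h hsub; grind
      · clear h hsub; grind)
    (by simp [add_comm]) (by simpa using hi)
  have hXi : ((X.disjSum (range #Y)).erase (Sum.inl i)).toLeft = X.erase i := by ext; simp
  rcases j with j | j
  · refine Or.inr ⟨j, by simpa using hj, ?_⟩
    have hYj : ((insert (Sum.inl i) (Y.disjSum (range #X))).erase (Sum.inl j)).toLeft =
        (insert i Y).erase j := by ext; simp
    simpa only [toLeft_insert_inl, hXi, hYj, toLeft_disjSum] using hle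
  · have hYj : ((insert (Sum.inl i) (Y.disjSum (range #X))).erase (Sum.inr j)).toLeft =
        insert i Y := by ext; simp
    left
    simpa only [toLeft_insert_inr, hXi, hYj, toLeft_disjSum] using hle

end LocalExchange

section Demand

variable {n : ℕ} {u : Finset (Fin n) → ℝ} {p : Fin n → ℝ} {X Y : Finset (Fin n)} {i j : Fin n}

theorem sum_erase_add_sum_insert (p : Fin n → ℝ) (hi : i ∈ X \ Y) :
    ∑ x ∈ X.erase i, p x + ∑ x ∈ insert i Y, p x = ∑ x ∈ X, p x + ∑ x ∈ Y, p x := by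
  obtain ⟨hX, hY⟩ := mem_sdiff.mp hi
  rw [sum_insert hY, ← add_sum_erase X p hX]
  ring

theorem sum_insert_erase_add_sum_erase_insert (p : Fin n → ℝ) (hi : i ∈ X \ Y)
    (hj : j ∈ Y \ X) :
    ∑ x ∈ insert j (X.erase i), p x + ∑ x ∈ (insert i Y).erase j, p x =
      ∑ x ∈ X, p x + ∑ x ∈ Y, p x := by
  obtain ⟨hY, hX⟩ := mem_sdiff.mp hj
  rw [sum_insert (by simp [hX]), ← sum_erase_add_sum_insert p hi,
    ← add_sum_erase (insert i Y) p (mem_insert_of_mem hY)]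
  ring

theorem mem_demandSet_of_add_le {X' Y' : Finset (Fin n)} (hX : X ∈ demandSet u p)
    (hY : Y ∈ demandSet u p)
    (hsum : ∑ x ∈ X', p x + ∑ x ∈ Y', p x = ∑ x ∈ X, p x + ∑ x ∈ Y, p x)
    (hle : u X + u Y ≤ u X' + u Y') : X' ∈ demandSet u p ∧ Y' ∈ demandSet u p := by
  refine ⟨fun T => ?_, fun T => ?_⟩
  · have := hX T; have := hY Y'; linarith
  · have := hX X'; have := hY T; linarith

theorem add_le_of_mem_demandSet {X' Y' : Finset (Fin n)} (hX : X' ∈ demandSet u p)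
    (hY : Y' ∈ demandSet u p)
    (hsum : ∑ x ∈ X', p x + ∑ x ∈ Y', p x = ∑ x ∈ X, p x + ∑ x ∈ Y, p x) :
    u X + u Y ≤ u X' + u Y' := by
  have := hX X; have := hY Y; linarith

/-- If `X` and `Y` are demanded at a common price, then M♮-convexity of the demand set gives
the exchange property of `u` for `X` and `Y`. -/
theorem exchange_of_mem_demandSet (hp : MConvexFamily (demandSet u p)) (hX : X ∈ demandSet u p)
    (hY : Y ∈ demandSet u p) (hi : i ∈ X \ Y) :
    u X + u Y ≤ u (X.erase i) + u (insert i Y) ∨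
      ∃ j ∈ Y \ X, u X + u Y ≤ u (insert j (X.erase i)) + u ((insert i Y).erase j) := by
  rcases hp X hX Y hY i hi with ⟨h₁, h₂⟩ | ⟨j, hj, h₁, h₂⟩
  · exact Or.inl (add_le_of_mem_demandSet h₁ h₂ (sum_erase_add_sum_insert p hi))
  · exact Or.inr ⟨j, hj,
      add_le_of_mem_demandSet h₁ h₂ (sum_insert_erase_add_sum_erase_insert p hi hj)⟩

/-- The price that equals `q` on `A`, vanishes on the rest of `S`, and is `u univ` elsewhere. -/
noncomputable def intervalPrice (u : Finset (Fin n) → ℝ) (S A : Finset (Fin n)) (q : Fin n → ℝ)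
    (x : Fin n) : ℝ :=
  if x ∈ A then q x else if x ∈ S then 0 else u univ

/-- A set `S ∪ B` with `B ⊆ A` that is optimal among the sets between `S` and `S ∪ A` is demanded
at the price `intervalPrice u S A q`. -/
theorem union_mem_demandSet_intervalPrice (hval : IsValuation univ u) {S A B : Finset (Fin n)}
    {q : Fin n → ℝ} (hSA : Disjoint S A) (hBA : B ⊆ A)
    (hB : ∀ C ⊆ A, u (S ∪ C) - ∑ x ∈ C, q x ≤ u (S ∪ B) - ∑ x ∈ B, q x) :
    S ∪ B ∈ demandSet u (intervalPrice u S A q) := by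
  obtain ⟨-, hnonneg, hmono⟩ := hval
  have hA {C : Finset (Fin n)} (hC : C ⊆ A) :
      ∑ x ∈ C, intervalPrice u S A q x = ∑ x ∈ C, q x :=
    sum_congr rfl fun x hx => by simp [intervalPrice, hC hx]
  have hS {C : Finset (Fin n)} (hC : C ⊆ S) : ∑ x ∈ C, intervalPrice u S A q x = 0 :=
    sum_eq_zero fun x hx => by
      simp [intervalPrice, hC hx, disjoint_left.mp hSA (hC hx)]
  intro T
  have hT : ∑ x ∈ T, intervalPrice u S A q x =
      ∑ x ∈ T ∩ A, q x + #((T \ A) \ S) * u univ := by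
    rw [← sum_inter_add_sum_sdiff T A, hA inter_subset_right,
      ← sum_inter_add_sum_sdiff (T \ A) S, hS inter_subset_right, zero_add, ← nsmul_eq_mul,
      ← sum_const]
    congr 1
    exact sum_congr rfl fun x hx => by
      simp only [mem_sdiff] at hx
      simp [intervalPrice, hx.1.2, hx.2]
  have hle : u T ≤ u (S ∪ T ∩ A) + #((T \ A) \ S) * u univ := by
    rcases ((T \ A) \ S).eq_empty_or_nonempty with h | h
    · rw [h, card_empty, Nat.cast_zero, zero_mul, add_zero]
      refine hmono (fun x hx => ?_) (subset_univ _)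
      have := Finset.ext_iff.mp h x
      grind
    · have h₁ : (1 : ℝ) ≤ #((T \ A) \ S) := by exact_mod_cast h.card_pos
      have h₂ := hmono (subset_univ T) (subset_univ _)
      have h₃ := hnonneg univ (subset_univ _)
      have h₄ := hnonneg (S ∪ T ∩ A) (subset_univ _)
      nlinarith
  have hopt := hB (T ∩ A) inter_subset_right
  rw [sum_union (disjoint_of_subset_right hBA hSA), hS subset_rfl, hA hBA, hT]
  linarith

theorem submodular_of_demandSet_mConvex (hval : IsValuation univ u)
    (hp : ∀ p : Fin n → ℝ, MConvexFamily (demandSet u p)) (S : Finset (Fin n)) (a b : Fin n)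
    (ha : a ∉ S) (hb : b ∉ S) (hab : a ≠ b) :
    u (insert a (insert b S)) + u S ≤ u (insert a S) + u (insert b S) := by
  by_contra! hlt
  set q : Fin n → ℝ := fun x =>
    if x = a then u (insert a S) - u S else u (insert a (insert b S)) - u (insert a S) with hq
  have hqa : q a = u (insert a S) - u S := by simp [hq]
  have hqb : q b = u (insert a (insert b S)) - u (insert a S) := by simp [hq, hab.symm]
  have hSA : Disjoint S {a, b} := by simp [ha, hb]
  have hopt : ∀ C ⊆ {a, b}, u (S ∪ C) - ∑ x ∈ C, q x ≤ u S := by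
    intro C hC
    have hC : C = ∅ ∨ C = {a} ∨ C = {b} ∨ C = {a, b} := by
      rw [← mem_powerset] at hC
      simp only [powerset_insert, powerset_empty, ← insert_empty_eq] at hC
      grind
    rcases hC with rfl | rfl | rfl | rfl <;>
      simp [hab, hqa, hqb, union_insert, union_singleton]
    linarith
  have hmem₀ : S ∪ ∅ ∈ demandSet u (intervalPrice u S {a, b} q) :=
    union_mem_demandSet_intervalPrice hval hSA (empty_subset _) fun C hC => by
      simpa using hopt C hC
  have hmem₁ : S ∪ {a, b} ∈ demandSet u (intervalPrice u S {a, b} q) := by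
    refine union_mem_demandSet_intervalPrice hval hSA subset_rfl fun C hC => ?_
    refine (hopt C hC).trans (le_of_eq ?_)
    rw [sum_pair hab, hqa, hqb, union_insert, union_singleton]
    ring
  rw [union_insert, union_singleton] at hmem₁
  rw [union_empty] at hmem₀
  rcases exchange_of_mem_demandSet (hp _) hmem₁ hmem₀ (i := a) (by simp [ha]) with h | ⟨j, hj, -⟩
  · rw [erase_insert (by grind)] at h
    linarith
  · grind

theorem exists_add_mem_Icc {la ha lb hb ls hs : ℝ} (h₁ : la ≤ ha) (h₂ : lb ≤ hb) (h₃ : ls ≤ hs)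
    (h₄ : la + lb ≤ hs) (h₅ : ls ≤ ha + hb) :
    ∃ a b : ℝ, la ≤ a ∧ a ≤ ha ∧ lb ≤ b ∧ b ≤ hb ∧ ls ≤ a + b ∧ a + b ≤ hs := by
  refine ⟨max la (max ls (la + lb) - hb), max ls (la + lb) - max la (max ls (la + lb) - hb), ?_⟩
  grind

theorem pair_singleton_exchange_of_demandSet_mConvex (hval : IsValuation univ u)
    (hp : ∀ p : Fin n → ℝ, MConvexFamily (demandSet u p)) (S : Finset (Fin n)) (a b c : Fin n)
    (ha : a ∉ S) (hb : b ∉ S) (hc : c ∉ S) (hab : a ≠ b) (hac : a ≠ c) (hbc : b ≠ c) :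
    u (insert a (insert b S)) + u (insert c S) ≤ u (insert b S) + u (insert a (insert c S)) ∨
      u (insert a (insert b S)) + u (insert c S) ≤ u (insert b (insert c S)) + u (insert a S) := by
  by_contra! hlt
  obtain ⟨hlt₁, hlt₂⟩ := hlt
  have hsub := submodular_of_demandSet_mConvex hval hp
  have s₁ := hsub S a c ha hc hac
  have s₂ := hsub S b c hb hc hbc
  have s₃ := hsub (insert a S) b c (by grind) (by grind) hbc
  have s₄ := hsub (insert b S) a c (by grind) (by grind) hac
  rw [insert_comm c a, insert_comm b a, insert_comm b a] at s₃
  rw [insert_comm c b] at s₄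
  obtain ⟨qa, qb, h₁, h₂, h₃, h₄, h₅, h₆⟩ := exists_add_mem_Icc
    (la := u (insert a (insert c S)) - u (insert c S))
    (ha := u (insert a (insert b S)) - u (insert b S))
    (lb := u (insert b (insert c S)) - u (insert c S))
    (hb := u (insert a (insert b S)) - u (insert a S))
    (ls := u (insert a (insert b (insert c S))) - u (insert c S))
    (hs := u (insert a (insert b S)) - u S)
    (by linarith) (by linarith) (by linarith) (by linarith) (by linarith)
  set q : Fin n → ℝ := fun x =>
    if x = a then qa else if x = b then qb
      else u (insert c S) - u (insert a (insert b S)) + qa + qb with hq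
  have hqa : q a = qa := by simp [hq]
  have hqb : q b = qb := by simp [hq, hab.symm]
  have hqc : q c = u (insert c S) - u (insert a (insert b S)) + qa + qb := by
    simp [hq, hac.symm, hbc.symm]
  have hSA : Disjoint S {a, b, c} := by simp [ha, hb, hc]
  have hopt : ∀ C ⊆ {a, b, c}, u (S ∪ C) - ∑ x ∈ C, q x ≤
      u (insert a (insert b S)) - qa - qb := by
    intro C hC
    have hC : C = ∅ ∨ C = {a} ∨ C = {b} ∨ C = {c} ∨ C = {a, b} ∨ C = {a, c} ∨ C = {b, c} ∨
        C = {a, b, c} := by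
      rw [← inter_eq_right] at hC
      by_cases a ∈ C <;> by_cases b ∈ C <;> by_cases c ∈ C <;>
        simp only [insert_inter_of_mem, insert_inter_of_notMem, singleton_inter_of_mem,
          singleton_inter_of_notMem, insert_empty_eq, *, not_false_eq_true] at hC <;>
        tauto
    rcases hC with rfl | rfl | rfl | rfl | rfl | rfl | rfl | rfl <;>
      simp [hab, hac, hbc, hqa, hqb, hqc, union_insert, union_singleton] <;> linarith
  have hmem₀ : S ∪ {c} ∈ demandSet u (intervalPrice u S {a, b, c} q) := by
    refine union_mem_demandSet_intervalPrice hval hSA (by simp) fun C hC => ?_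
    refine (hopt C hC).trans (le_of_eq ?_)
    rw [union_singleton, sum_singleton, hqc]
    ring
  have hmem₁ : S ∪ {a, b} ∈ demandSet u (intervalPrice u S {a, b, c} q) := by
    refine union_mem_demandSet_intervalPrice hval hSA (by grind) fun C hC => ?_
    refine (hopt C hC).trans (le_of_eq ?_)
    rw [sum_pair hab, hqa, hqb, union_insert, union_singleton]
    ring
  rw [union_insert, union_singleton] at hmem₁
  rw [union_singleton] at hmem₀
  rcases exchange_of_mem_demandSet (hp _) hmem₁ hmem₀ (i := a) (by grind) with h | ⟨j, hj, h⟩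
  · rw [erase_insert (by grind)] at h
    linarith
  · obtain rfl : j = c := by grind
    rw [erase_insert (by grind), erase_insert_of_ne hac, erase_insert (by grind),
      insert_comm j b] at h
    linarith

end Demand

/-- A valuation on `[n]` is gross substitutes (satisfies the M♮-exchange
property) iff all of its demand sets are M♮-convex families. -/
theorem grossSubstitutes_iff_demand_mconvex (n : ℕ)
    (u : Finset (Fin n) → ℝ)
    (hval : IsValuation (Finset.univ : Finset (Fin n)) u) :
    GrossSubstitutes (Finset.univ : Finset (Fin n)) u ↔
      ∀ p : Fin n → ℝ, MConvexFamily (demandSet u p) := by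
  refine ⟨fun h p X hX Y hY i hi => ?_, fun hp => ⟨hval, fun X Y _ _ i hi =>
    exchange_of_local_exchange (submodular_of_demandSet_mConvex hval hp)
      (pair_singleton_exchange_of_demandSet_mConvex hval hp) X Y hi⟩⟩
  rcases h.2 (subset_univ X) (subset_univ Y) i hi with hle | ⟨j, hj, hle⟩
  · exact Or.inl (mem_demandSet_of_add_le hX hY (sum_erase_add_sum_insert p hi) hle)
  · exact Or.inr ⟨j, hj, mem_demandSet_of_add_le hX hY
      (sum_insert_erase_add_sum_erase_insert p hi hj) hle⟩
end
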